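/- arXiv:2010.02719 — 15 statements merged into one kernel-verified Lean document; each statement's English description precedes it below -/
import Mathlib

section
/- Let γ : ℝ → ℝ² be a smooth curve with [γ(t), γ'(t)] = 1 for all t, and let p : ℝ → ℝ satisfy γ''(t) = p(t)·γ(t) for all t. Let c ∈ ℝ, let f, g : ℝ → ℝ be differentiable, and set δ(t) = f(t)·γ(t) + g(t)·γ'(t). Then ([γ(t), δ(t)] = c for all t and [δ(t), δ'(t)] = 1 for all t) if and only if (g(t) = c for all t and c·f'(t) − f(t)² + c²·p(t) + 1 = 0 for all t). -/
open Real

/-- The determinant `[u, v] = u₁v₂ − u₂v₁` of two plane vectors. -/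
noncomputable def cdet (u v : ℝ × ℝ) : ℝ := u.1 * v.2 - u.2 * v.1

theorem cdet_add_smul_left_self (a b : ℝ) (u v : ℝ × ℝ) :
    cdet u (a • u + b • v) = b * cdet u v := by
  simp only [cdet, Prod.fst_add, Prod.snd_add, Prod.smul_fst, Prod.smul_snd, smul_eq_mul]
  ring

theorem cdet_add_smul_add_smul (a b x y : ℝ) (u v : ℝ × ℝ) :
    cdet (a • u + b • v) (x • u + y • v) = (a * y - b * x) * cdet u v := by
  simp only [cdet, Prod.fst_add, Prod.snd_add, Prod.smul_fst, Prod.smul_snd, smul_eq_mul]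
  ring

/-- Lemma 2.1: given a centroaffine curve `γ` with curvature `p`, the curve
`δ = f·γ + g·γ'` is centroaffine and `c`-related to `γ` iff `g ≡ c` and `f`
satisfies the Riccati equation `c f' − f² + c² p + 1 = 0`. -/
theorem stmt0 (γ : ℝ → ℝ × ℝ) (hγ : ContDiff ℝ (⊤ : ℕ∞) γ)
    (hW : ∀ t, cdet (γ t) (deriv γ t) = 1)
    (p : ℝ → ℝ) (hp : ∀ t, deriv (deriv γ) t = p t • γ t)
    (c : ℝ) (f g : ℝ → ℝ) (hf : Differentiable ℝ f) (hg : Differentiable ℝ g)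
    (δ : ℝ → ℝ × ℝ) (hδ : ∀ t, δ t = f t • γ t + g t • deriv γ t) :
    ((∀ t, cdet (γ t) (δ t) = c) ∧ (∀ t, cdet (δ t) (deriv δ t) = 1)) ↔
      ((∀ t, g t = c) ∧
        (∀ t, c * deriv f t - (f t) ^ 2 + c ^ 2 * p t + 1 = 0)) := by
  have hδ_eq : δ = fun t => f t • γ t + g t • deriv γ t := funext hδ
  have hγ_diff : Differentiable ℝ γ := hγ.differentiable (by simp)
  have hγ'_diff : Differentiable ℝ (deriv γ) :=
    (contDiff_infty_iff_deriv.1 hγ).2.differentiable (by simp)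
  have hδ_deriv (t : ℝ) :
      deriv δ t = (deriv f t + g t * p t) • γ t + (f t + deriv g t) • deriv γ t := by
    have h := ((hf t).hasDerivAt.smul (hγ_diff t).hasDerivAt).add
      ((hg t).hasDerivAt.smul (hγ'_diff t).hasDerivAt)
    rw [hδ_eq]
    refine h.deriv.trans ?_
    rw [hp]
    module
  have h_rel (t : ℝ) : cdet (γ t) (δ t) = g t := by
    rw [hδ, cdet_add_smul_left_self, hW, mul_one]
  have h_wronskian (t : ℝ) : cdet (δ t) (deriv δ t) =
      f t * (f t + deriv g t) - g t * (deriv f t + g t * p t) := by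
    rw [hδ_deriv, hδ, cdet_add_smul_add_smul, hW, mul_one]
  simp only [h_rel, h_wronskian]
  refine and_congr_right fun hgc => forall_congr' fun t => ?_
  obtain rfl : g = fun _ => c := funext hgc
  simp only [deriv_const]
  constructor <;> intro h <;> linear_combination -h
end

section
/- Let Γ : ℝ → ℝ² be smooth with [Γ(s), Γ'(s)] = 1 for all s, and let p : ℝ → ℝ satisfy Γ''(s) = p(s)·Γ(s). Fix c ∈ ℝ and set γ₊ = Γ + (c/2)·Γ' and γ₋ = Γ − (c/2)·Γ'. Then [γ₊(s), γ₊'(s)] = [γ₋(s), γ₋'(s)] = 1 − c²p(s)/4 for all s. Moreover, suppose 1 − c²p(s)/4 ≠ 0 for all s, let φ(s) = ∫₀^s (1 − c²p(u)/4) du, and let h be differentiable on an open interval I with φ(h(t)) = t for all t ∈ I; then the reparametrized curves γ̃± = γ± ∘ h satisfy [γ̃±(t), γ̃±'(t)] = 1 for all t ∈ I. -/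
open Real intervalIntegral

theorem cdet_smul_right (r : ℝ) (u v : ℝ × ℝ) : cdet u (r • v) = r * cdet u v := by
  simp only [cdet, Prod.smul_fst, Prod.smul_snd, smul_eq_mul]
  ring

theorem cdet_add_smul (u v : ℝ × ℝ) (k q : ℝ) :
    cdet (u + k • v) (v + k • q • u) = (1 - k ^ 2 * q) * cdet u v := by
  simp only [cdet, Prod.smul_fst, Prod.smul_snd, Prod.fst_add, Prod.snd_add, smul_eq_mul]
  ring

/-- The curvature of a centroaffine curve is continuous. -/
theorem continuous_curvature {Γ : ℝ → ℝ × ℝ} (hΓ : ContDiff ℝ 2 Γ)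
    (hW : ∀ s, cdet (Γ s) (deriv Γ s) = 1) {p : ℝ → ℝ}
    (hp : ∀ s, deriv (deriv Γ) s = p s • Γ s) : Continuous p := by
  have hp' : p = fun s => cdet (deriv (deriv Γ) s) (deriv Γ s) := by
    funext s
    have hWs := hW s
    rw [hp]
    simp only [cdet, Prod.smul_fst, Prod.smul_snd, smul_eq_mul] at hWs ⊢
    linear_combination -p s * hWs
  have h1 : ContDiff ℝ 1 (deriv Γ) := hΓ.deriv'
  have h2 : Continuous (deriv Γ) := h1.continuous
  have h3 : Continuous (deriv (deriv Γ)) := h1.continuous_deriv le_rfl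
  rw [hp']
  unfold cdet
  fun_prop

theorem hasDerivAt_add_smul_deriv {Γ : ℝ → ℝ × ℝ} (hΓ : ContDiff ℝ 2 Γ) {p : ℝ → ℝ}
    (hp : ∀ s, deriv (deriv Γ) s = p s • Γ s) (k s : ℝ) :
    HasDerivAt (fun s => Γ s + k • deriv Γ s) (deriv Γ s + k • p s • Γ s) s := by
  have h1 : ContDiff ℝ 1 (deriv Γ) := hΓ.deriv'
  have h2 := (h1.differentiable one_ne_zero s).hasDerivAt
  rw [hp] at h2
  exact (hΓ.differentiable two_ne_zero s).hasDerivAt.add (h2.const_smul k)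

/-- A local right inverse of a primitive of `f` has derivative `1 / f`. -/
theorem mul_deriv_eq_one_of_integral_comp {f h : ℝ → ℝ} (hf : Continuous f) {a b t : ℝ}
    (ht : t ∈ Set.Ioo a b) (hh : DifferentiableAt ℝ h t)
    (hinv : ∀ t ∈ Set.Ioo a b, ∫ u in (0 : ℝ)..h t, f u = t) : deriv h t * f (h t) = 1 := by
  have h1 : HasDerivAt (fun t => ∫ u in (0 : ℝ)..h t, f u) (f (h t) * deriv h t) t :=
    (hf.integral_hasStrictDerivAt 0 (h t)).hasDerivAt.comp t hh.hasDerivAt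
  have h2 : (fun t => ∫ u in (0 : ℝ)..h t, f u) =ᶠ[nhds t] id :=
    Filter.eventuallyEq_of_mem (isOpen_Ioo.mem_nhds ht) hinv
  rw [mul_comm]
  exact (h1.congr_of_eventuallyEq h2.symm).unique (hasDerivAt_id t)

/-- Proposition 2.4: for a centroaffine curve `Γ` with curvature `p`, the curves
`γ± = Γ ± (c/2)Γ'` satisfy `[γ±, γ±'] = 1 − c²p/4`; and if `1 − c²p/4` never
vanishes, reparametrizing by the inverse of `φ(s) = ∫₀^s (1 − c²p/4)` makes
them centroaffine curves. -/
theorem stmt2 (Γ : ℝ → ℝ × ℝ) (hΓ : ContDiff ℝ (⊤ : ℕ∞) Γ)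
    (hW : ∀ s, cdet (Γ s) (deriv Γ s) = 1)
    (p : ℝ → ℝ) (hp : ∀ s, deriv (deriv Γ) s = p s • Γ s)
    (c : ℝ)
    (γp γm : ℝ → ℝ × ℝ)
    (hγp : ∀ s, γp s = Γ s + (c/2) • deriv Γ s)
    (hγm : ∀ s, γm s = Γ s - (c/2) • deriv Γ s) :
    (∀ s, cdet (γp s) (deriv γp s) = 1 - c^2 * p s / 4 ∧
          cdet (γm s) (deriv γm s) = 1 - c^2 * p s / 4) ∧
    ((∀ s, 1 - c^2 * p s / 4 ≠ 0) →
      ∀ (φ : ℝ → ℝ), (∀ s, φ s = ∫ u in (0:ℝ)..s, (1 - c^2 * p u / 4)) →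
      ∀ (a b : ℝ) (h : ℝ → ℝ),
        (∀ t ∈ Set.Ioo a b, DifferentiableAt ℝ h t) →
        (∀ t ∈ Set.Ioo a b, φ (h t) = t) →
        ∀ t ∈ Set.Ioo a b,
          cdet ((γp ∘ h) t) (deriv (γp ∘ h) t) = 1 ∧
          cdet ((γm ∘ h) t) (deriv (γm ∘ h) t) = 1) := by
  have hΓ2 : ContDiff ℝ 2 Γ := contDiff_infty.1 hΓ 2
  have hγ (k : ℝ) (hk : k ^ 2 = c ^ 2 / 4) (γ : ℝ → ℝ × ℝ)
      (hγ : ∀ s, γ s = Γ s + k • deriv Γ s) :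
      (∀ s, DifferentiableAt ℝ γ s) ∧ ∀ s, cdet (γ s) (deriv γ s) = 1 - c ^ 2 * p s / 4 := by
    have hd (s : ℝ) := hasDerivAt_add_smul_deriv hΓ2 hp k s
    rw [← funext hγ] at hd
    refine ⟨fun s => (hd s).differentiableAt, fun s => ?_⟩
    rw [(hd s).deriv, hγ, cdet_add_smul, hW, hk]
    ring
  obtain ⟨hdp, hp1⟩ := hγ (c / 2) (by ring) γp hγp
  obtain ⟨hdm, hm1⟩ := hγ (-(c / 2)) (by ring) γm fun s => by
    rw [hγm, neg_smul, sub_eq_add_neg]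
  refine ⟨fun s => ⟨hp1 s, hm1 s⟩, fun _ φ hφ a b h hh hinv t ht => ?_⟩
  have hcont : Continuous p := continuous_curvature hΓ2 hW hp
  have hmul : deriv h t * (1 - c ^ 2 * p (h t) / 4) = 1 :=
    mul_deriv_eq_one_of_integral_comp (f := fun u => 1 - c ^ 2 * p u / 4) (by fun_prop) ht
      (hh t ht) fun t ht => by rw [← hφ, hinv t ht]
  constructor
  · rw [deriv.scomp t (hdp _) (hh t ht), cdet_smul_right, Function.comp_apply, hp1, hmul]
  · rw [deriv.scomp t (hdm _) (hh t ht), cdet_smul_right, Function.comp_apply, hm1, hmul]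
end

section
/- Let c > 1, a = √(c² − 1), u = a/c, and define δ(t) = a·tan(at/c)·(cos t, sin t) + c·(−sin t, cos t) for all t with cos(ut) ≠ 0. Let α ∈ (0, π). Then there exists a constant C ∈ ℝ such that [δ(t), δ(t+α)] = C for every t with cos(ut) ≠ 0 and cos(u(t+α)) ≠ 0, if and only if sin(uα)·cos α = u·sin α·cos(uα) (i.e. tan(uα) = u·tan α); and in that case C = sin α. -/
open Real

/-- Two points of the curve at parameter distance `α` span the area `sin α`, up to a defect
inversely proportional to `cos (u * t) * cos (u * (t + α))`. -/
theorem cdet_darboux_circle {c a u : ℝ} (hac : a ^ 2 = c ^ 2 - 1) (hau : a = u * c) {t α : ℝ}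
    (h₁ : cos (u * t) ≠ 0) (h₂ : cos (u * (t + α)) ≠ 0) :
    cdet ((a * tan (u * t)) • (cos t, sin t) + c • (-sin t, cos t))
        ((a * tan (u * (t + α))) • (cos (t + α), sin (t + α)) +
          c • (-sin (t + α), cos (t + α))) =
      sin α + a * c * (u * sin α * cos (u * α) - sin (u * α) * cos α) /
        (cos (u * t) * cos (u * (t + α))) := by
  have hs : sin α = sin (t + α) * cos t - cos (t + α) * sin t := by
    rw [← sin_sub]; ring_nf
  have hc : cos α = cos (t + α) * cos t + sin (t + α) * sin t := by
    rw [← cos_sub]; ring_nf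
  have hsu : sin (u * α) = sin (u * (t + α)) * cos (u * t) - cos (u * (t + α)) * sin (u * t) := by
    rw [← sin_sub]; ring_nf
  have hcu : cos (u * α) = cos (u * (t + α)) * cos (u * t) + sin (u * (t + α)) * sin (u * t) := by
    rw [← cos_sub]; ring_nf
  have hdet : cdet ((a * tan (u * t)) • (cos t, sin t) + c • (-sin t, cos t))
        ((a * tan (u * (t + α))) • (cos (t + α), sin (t + α)) +
          c • (-sin (t + α), cos (t + α))) =
      (a ^ 2 * tan (u * t) * tan (u * (t + α)) + c ^ 2) * sin α +
        a * c * (tan (u * t) - tan (u * (t + α))) * cos α := by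
    rw [hs, hc]
    simp only [cdet, Prod.smul_mk, Prod.mk_add_mk, smul_eq_mul]
    ring
  have hc2 : c ^ 2 = a ^ 2 + 1 := by linarith
  have hcua : a * c * u = a ^ 2 := by rw [hau]; ring
  have hsplit : a * c * (u * sin α * cos (u * α) - sin (u * α) * cos α) =
      a ^ 2 * sin α * cos (u * α) - a * c * sin (u * α) * cos α := by rw [← hcua]; ring
  rw [hdet, hsplit, hc2, hsu, hcu, tan_eq_sin_div_cos, tan_eq_sin_div_cos]
  field_simp
  ring

/-- Lemma 2.6: the curve `δ = a·tan(at/c)·(cos t, sin t) + c·(−sin t, cos t)`,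
`c`-related to the unit circle (`c > 1`, `a = √(c²−1)`, `u = a/c`), is
self-Bäcklund with rotation number `α ∈ (0, π)` iff `tan(uα) = u·tan α`,
in which case the constant determinant equals `sin α`. -/
theorem stmt3 (c : ℝ) (hc : 1 < c) (a u : ℝ)
    (ha : a = Real.sqrt (c^2 - 1)) (hu : u = a / c)
    (δ : ℝ → ℝ × ℝ)
    (hδ : ∀ t, δ t = (a * Real.tan (a * t / c)) • (Real.cos t, Real.sin t)
        + c • (-Real.sin t, Real.cos t))
    (α : ℝ) (hα : α ∈ Set.Ioo 0 π) :
    ((∃ C : ℝ, ∀ t, Real.cos (u * t) ≠ 0 → Real.cos (u * (t + α)) ≠ 0 →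
        cdet (δ t) (δ (t + α)) = C) ↔
      Real.sin (u * α) * Real.cos α = u * Real.sin α * Real.cos (u * α)) ∧
    (Real.sin (u * α) * Real.cos α = u * Real.sin α * Real.cos (u * α) →
      ∀ t, Real.cos (u * t) ≠ 0 → Real.cos (u * (t + α)) ≠ 0 →
        cdet (δ t) (δ (t + α)) = Real.sin α) := by
  obtain ⟨hα₀, hαπ⟩ := hα
  have hc₀ : 0 < c := by linarith
  have hac : a ^ 2 = c ^ 2 - 1 := by rw [ha, sq_sqrt]; nlinarith
  have ha₀ : 0 < a := by rw [ha]; apply sqrt_pos.2; nlinarith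
  have hau : a = u * c := by rw [hu]; field_simp
  have hu₀ : 0 < u := by rw [hu]; positivity
  have hu₁ : u < 1 := by rw [hu, div_lt_one hc₀]; nlinarith
  have key : ∀ t, cos (u * t) ≠ 0 → cos (u * (t + α)) ≠ 0 → cdet (δ t) (δ (t + α)) =
      sin α + a * c * (u * sin α * cos (u * α) - sin (u * α) * cos α) /
        (cos (u * t) * cos (u * (t + α))) := by
    intro t h₁ h₂
    have hmul : ∀ s, a * s / c = u * s := fun s => by rw [hu]; ring
    rw [hδ, hδ, hmul, hmul]
    exact cdet_darboux_circle hac hau h₁ h₂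
  have hconst : sin (u * α) * cos α = u * sin α * cos (u * α) →
      ∀ t, cos (u * t) ≠ 0 → cos (u * (t + α)) ≠ 0 → cdet (δ t) (δ (t + α)) = sin α := by
    intro h t h₁ h₂
    rw [key t h₁ h₂, h]
    simp
  refine ⟨⟨?_, fun h => ⟨sin α, hconst h⟩⟩, hconst⟩
  rintro ⟨C, hC⟩
  set p := u * α / 2 with hp
  have hp₀ : 0 < p := by positivity
  have hp₁ : p < π / 2 := by nlinarith
  have hcos : 0 < cos p := cos_pos_of_mem_Ioo ⟨by linarith, hp₁⟩
  have hsin : 0 < sin p := sin_pos_of_pos_of_lt_pi hp₀ (by linarith)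
  have e₁ : cos (u * (-α / 2)) = cos p := by rw [← cos_neg p]; congr 1; rw [hp]; ring
  have e₂ : cos (u * (-α / 2 + α)) = cos p := by congr 1; rw [hp]; ring
  have e₃ : cos (u * (π / 2 / u - α / 2)) = sin p := by
    rw [← cos_pi_div_two_sub]; congr 1; rw [hp]; field_simp
  have e₄ : cos (u * (π / 2 / u - α / 2 + α)) = -sin p := by
    rw [← cos_add_pi_div_two]; congr 1; rw [hp]; field_simp; ring
  have v₁ : cos (u * (-α / 2)) ≠ 0 := e₁ ▸ hcos.ne'
  have v₂ : cos (u * (-α / 2 + α)) ≠ 0 := e₂ ▸ hcos.ne'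
  have v₃ : cos (u * (π / 2 / u - α / 2)) ≠ 0 := e₃ ▸ hsin.ne'
  have v₄ : cos (u * (π / 2 / u - α / 2 + α)) ≠ 0 := e₄ ▸ neg_ne_zero.2 hsin.ne'
  have h := (hC _ v₁ v₂).trans (hC _ v₃ v₄).symm
  rw [key _ v₁ v₂, key _ v₃ v₄, e₁, e₂, e₃, e₄, add_right_inj,
    div_eq_div_iff (by positivity) (mul_ne_zero hsin.ne' (neg_ne_zero.2 hsin.ne'))] at h
  have hK : a * c * (u * sin α * cos (u * α) - sin (u * α) * cos α) = 0 := by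
    linear_combination -h -
      a * c * (u * sin α * cos (u * α) - sin (u * α) * cos α) * sin_sq_add_cos_sq p
  have := (mul_eq_zero.1 hK).resolve_left (by positivity)
  linarith
end

section
/- Let p : ℝ → ℝ be continuous and π-periodic, and let c ≠ 0 be a real number. Then the Riccati equation c·f'(t) − f(t)² + c²·p(t) + 1 = 0 admits a differentiable π-periodic solution f : ℝ → ℝ if and only if the Hill equation y''(t) + (λ − p(t))·y(t) = 0 with λ = −1/c² admits a twice differentiable solution y : ℝ → ℝ with y(t) > 0 for all t that is π-quasiperiodic, i.e. there exists μ ∈ ℝ, μ ≠ 0, with y(t + π) = μ·y(t) for all t. -/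
open Real

/-- The exponential of the primitive of a continuous `u` solves `y' = u y`. -/
lemma hasDerivAt_exp_integral {u : ℝ → ℝ} (hu : Continuous u) (t : ℝ) :
    HasDerivAt (fun s => exp (∫ x in (0 : ℝ)..s, u x)) (u t * exp (∫ x in (0 : ℝ)..t, u x)) t := by
  have h := (hu.integral_hasStrictDerivAt 0 t).hasDerivAt.exp
  rwa [mul_comm] at h

/-- The exponential of a primitive of a `T`-periodic function is quasiperiodic. -/
lemma exp_integral_add_period {u : ℝ → ℝ} {T : ℝ} (hu : Continuous u)
    (hT : Function.Periodic u T) (t : ℝ) :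
    exp (∫ x in (0 : ℝ)..(t + T), u x) =
      exp (∫ x in (0 : ℝ)..T, u x) * exp (∫ x in (0 : ℝ)..t, u x) := by
  have h := hT.intervalIntegral_add_eq t 0
  rw [zero_add] at h
  rw [← intervalIntegral.integral_add_adjacent_intervals
    (hu.intervalIntegrable 0 t) (hu.intervalIntegrable t (t + T)), h, exp_add, mul_comm]

/-- Proposition 2.11: the Riccati equation `c f' − f² + c² p + 1 = 0` with
π-periodic `p` has a π-periodic solution for a parameter `c ≠ 0` iff the Hill
equation `y'' + (λ − p) y = 0` with `λ = −1/c²` has a positive π-quasiperiodic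
solution. -/
theorem stmt5 (p : ℝ → ℝ) (hpc : Continuous p) (hpper : ∀ t, p (t + π) = p t)
    (c : ℝ) (hc : c ≠ 0) :
    (∃ f : ℝ → ℝ, Differentiable ℝ f ∧ (∀ t, f (t + π) = f t) ∧
        ∀ t, c * deriv f t - (f t)^2 + c^2 * p t + 1 = 0) ↔
    (∃ y : ℝ → ℝ, Differentiable ℝ y ∧ Differentiable ℝ (deriv y) ∧
        (∀ t, deriv (deriv y) t + (-1 / c^2 - p t) * y t = 0) ∧
        (∀ t, 0 < y t) ∧
        ∃ μ : ℝ, μ ≠ 0 ∧ ∀ t, y (t + π) = μ * y t) := by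
  constructor
  · rintro ⟨f, hf, hper, hode⟩
    set u : ℝ → ℝ := fun t => -f t / c with hu_def
    have hu (t : ℝ) : HasDerivAt u (-deriv f t / c) t := (hf t).hasDerivAt.neg.div_const c
    have huc : Continuous u := hf.continuous.neg.div_const c
    have huper : Function.Periodic u π := fun t => by simp only [hu_def, hper]
    set y : ℝ → ℝ := fun s => exp (∫ x in (0 : ℝ)..s, u x) with hy_def
    have hy (t : ℝ) : HasDerivAt y (u t * y t) t := hasDerivAt_exp_integral huc t
    have hdy : deriv y = fun t => u t * y t := funext fun t => (hy t).deriv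
    have hddy (t : ℝ) : HasDerivAt (deriv y) (-deriv f t / c * y t + u t * (u t * y t)) t := by
      rw [hdy]
      exact (hu t).mul (hy t)
    refine ⟨y, fun t => (hy t).differentiableAt, fun t => (hddy t).differentiableAt, fun t => ?_,
      fun t => exp_pos _, exp (∫ x in (0 : ℝ)..π, u x), (exp_pos _).ne',
      exp_integral_add_period huc huper⟩
    rw [(hddy t).deriv]
    simp only [hu_def]
    field_simp
    linear_combination (-y t) * hode t
  · rintro ⟨y, hy, hdy, hode, hpos, μ, hμ, hquasi⟩
    have hdquasi (t : ℝ) : deriv y (t + π) = μ * deriv y t := by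
      rw [← deriv_comp_add_const, funext hquasi, deriv_const_mul _ (hy t)]
    have hf (t : ℝ) : HasDerivAt (fun s => -c * (deriv y s / y s))
        (-c * ((deriv (deriv y) t * y t - deriv y t * deriv y t) / y t ^ 2)) t :=
      ((hdy t).hasDerivAt.div (hy t).hasDerivAt (hpos t).ne').const_mul (-c)
    refine ⟨fun s => -c * (deriv y s / y s), fun t => (hf t).differentiableAt, fun t => ?_,
      fun t => ?_⟩
    · simp only [hdquasi, hquasi, mul_div_mul_left _ _ hμ]
    · have hyt := (hpos t).ne'
      have h := hode t
      rw [(hf t).deriv]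
      field_simp at h ⊢
      linear_combination (-y t) * h
end

section
/- Let p : ℝ → ℝ be continuous and π-periodic and let λ ∈ ℝ. Suppose y : ℝ → ℝ is twice differentiable, π-periodic, positive everywhere, and satisfies y''(t) + (λ − p(t))·y(t) = 0 for all t. Then λ ≤ (1/π)·∫₀^π p(t) dt; equivalently, setting P = −(1/π)∫₀^π p(t) dt, one has λ ≤ −P. -/
open Real

/-- Borg's inequality (Lemma 2.12): if the Hill equation `y'' + (λ − p) y = 0`
with continuous π-periodic potential `p` admits a positive π-periodic solution,
then `λ ≤ (1/π) ∫₀^π p`, i.e. `λ ≤ −P` where `P = −(1/π) ∫₀^π p`. -/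
theorem stmt6 (p : ℝ → ℝ) (hpc : Continuous p) (hpper : ∀ t, p (t + π) = p t)
    (lam : ℝ) (y : ℝ → ℝ)
    (hy1 : Differentiable ℝ y) (hy2 : Differentiable ℝ (deriv y))
    (hyper : ∀ t, y (t + π) = y t) (hypos : ∀ t, 0 < y t)
    (hODE : ∀ t, deriv (deriv y) t + (lam - p t) * y t = 0) :
    lam ≤ (1 / π) * ∫ t in (0:ℝ)..π, p t := by
  have hu : ∀ t, HasDerivAt (fun t => deriv y t / y t)
      (p t - lam - (deriv y t / y t) ^ 2) t := by
    intro t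
    have hyt : y t ≠ 0 := (hypos t).ne'
    refine ((hy2 t).hasDerivAt.fun_div (hy1 t).hasDerivAt hyt).congr_deriv ?_
    have h : deriv (deriv y) t = (p t - lam) * y t := by linarith [hODE t]
    rw [h]
    field_simp
  have hcu : Continuous fun t => (deriv y t / y t) ^ 2 :=
    (hy2.continuous.div hy1.continuous fun t => (hypos t).ne').pow 2
  have hcp : Continuous fun t => p t - lam := hpc.sub continuous_const
  have hdper : deriv y π = deriv y 0 := by
    have h := deriv_comp_add_const y π 0
    rw [show (fun t => y (t + π)) = y from funext hyper, zero_add] at h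
    exact h.symm
  have hyπ : y π = y 0 := by simpa using hyper 0
  have hint := intervalIntegral.integral_eq_sub_of_hasDerivAt (a := 0) (b := π)
    (fun t _ => hu t) ((hcp.sub hcu).intervalIntegrable 0 π)
  rw [intervalIntegral.integral_sub (hcp.intervalIntegrable 0 π) (hcu.intervalIntegrable 0 π),
    intervalIntegral.integral_sub (hpc.intervalIntegrable 0 π) intervalIntegrable_const,
    intervalIntegral.integral_const, hdper, hyπ, sub_self, sub_zero, smul_eq_mul] at hint
  have hnonneg : 0 ≤ ∫ t in (0:ℝ)..π, (deriv y t / y t) ^ 2 :=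
    intervalIntegral.integral_nonneg pi_pos.le fun t _ => sq_nonneg _
  rw [one_div_mul_eq_div, le_div_iff₀ pi_pos]
  linarith
end

section
/- Let q : ℝ → ℝ be continuous with q(t + π) = q(t) for all t. Then the following are equivalent: (i) the equation y'' + q·y = 0 has no conjugate points, i.e. every twice differentiable solution y with y(t₁) = y(t₂) = 0 for two distinct points t₁ ≠ t₂ is identically zero; (ii) the equation y'' + q·y = 0 admits a twice differentiable solution y with y(t) > 0 for all t that is π-quasiperiodic, i.e. there exists μ ∈ ℝ with y(t + π) = μ·y(t) for all t. -/
open scoped Nat in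
/-- A linear differential equation `x' = A(t) x` with continuous bounded coefficient has a global
solution with any prescribed value at `0`. -/
theorem exists_hasDerivAt_linear {E : Type*} [NormedAddCommGroup E] [NormedSpace ℝ E]
    [CompleteSpace E] (A : ℝ → E →L[ℝ] E) (hA : Continuous A) (K : ℝ) (hK : ∀ t, ‖A t‖ ≤ K)
    (x₀ : E) : ∃ x : ℝ → E, x 0 = x₀ ∧ ∀ t, HasDerivAt x (A t (x t)) t := by
  have hK0 : 0 ≤ K := (norm_nonneg _).trans (hK 0)
  let X : ℕ → ℝ → E := fun n => n.rec (fun _ => x₀) fun _ f t => ∫ s in (0 : ℝ)..t, A s (f s)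
  have hX_succ (n : ℕ) : X (n + 1) = fun t => ∫ s in (0 : ℝ)..t, A s (X n s) := rfl
  have hderiv_of_cont (n : ℕ) (hn : Continuous (X n)) (t : ℝ) :
      HasDerivAt (X (n + 1)) (A t (X n t)) t := by
    rw [hX_succ]
    exact ((hA.clm_apply hn).integral_hasStrictDerivAt 0 t).hasDerivAt
  have hcont (n : ℕ) : Continuous (X n) := by
    induction n with
    | zero => exact continuous_const
    | succ n hn =>
      exact continuous_iff_continuousAt.2 fun t => (hderiv_of_cont n hn t).continuousAt
  have hderiv (n : ℕ) := hderiv_of_cont n (hcont n)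
  have hbound (n : ℕ) (t : ℝ) : ‖X n t‖ ≤ (K * |t|) ^ n / n ! * ‖x₀‖ := by
    induction n generalizing t with
    | zero => simp [X]
    | succ n hn =>
      rw [hX_succ]
      calc ‖∫ s in (0 : ℝ)..t, A s (X n s)‖
          ≤ ∫ s in Set.uIoc 0 t, K ^ (n + 1) / n ! * ‖x₀‖ * |s - 0| ^ n := by
            rw [intervalIntegral.norm_intervalIntegral_eq]
            refine MeasureTheory.norm_integral_le_of_norm_le
              (Continuous.integrableOn_uIoc (by fun_prop)) (.of_forall fun s => ?_)
            calc ‖A s (X n s)‖ ≤ K * ((K * |s|) ^ n / n ! * ‖x₀‖) :=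
                  (A s).le_of_opNorm_le_of_le (hK s) (hn s)
              _ = K ^ (n + 1) / n ! * ‖x₀‖ * |s - 0| ^ n := by
                  rw [sub_zero]; ring
        _ = (K * |t|) ^ (n + 1) / (n + 1)! * ‖x₀‖ := by
            rw [MeasureTheory.integral_const_mul, integral_pow_abs_sub_uIoc, sub_zero,
              Nat.factorial_succ]
            push_cast
            field_simp
            ring
  have hsummable (R : ℝ) : Summable fun n : ℕ => (K * R) ^ n / n ! * ‖x₀‖ :=
    (Real.summable_pow_div_factorial _).mul_right _
  have hX_summable (t : ℝ) : Summable fun n => X n t :=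
    .of_norm_bounded (hsummable |t|) fun n => hbound n t
  have hX_zero (n : ℕ) : X (n + 1) 0 = 0 := by simp [hX_succ]
  refine ⟨fun t => x₀ + ∑' n, X (n + 1) t, by simp [hX_zero], fun t => ?_⟩
  have hsplit : x₀ + ∑' n, X (n + 1) t = ∑' n, X n t := (hX_summable t).tsum_eq_zero_add.symm
  have hsum : HasDerivAt (fun t => ∑' n, X (n + 1) t) (∑' n, A t (X n t)) t := by
    refine hasDerivAt_tsum_of_isPreconnected (t := Metric.ball 0 (|t| + 1)) (y₀ := 0)
      ((hsummable (|t| + 1)).mul_left K) Metric.isOpen_ball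
      (convex_ball _ _).isPreconnected (fun n s _ => hderiv n s) (fun n s hs => ?_)
      (by simp; positivity) (by simp [hX_zero]) (by simp)
    have hs' : |s| ≤ |t| + 1 := by simpa using (Metric.mem_ball.1 hs).le
    refine (A s).le_of_opNorm_le_of_le (hK s) ((hbound n s).trans ?_)
    gcongr
  simpa [hsplit, (A t).map_tsum (hX_summable t)] using hsum.const_add x₀

/-- `y` solves Hill's equation `y'' + q y = 0`, with derivative `y'`. -/
structure IsHillSolution (q y y' : ℝ → ℝ) : Prop where
  hasDerivAt (t : ℝ) : HasDerivAt y (y' t) t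
  hasDerivAt_deriv (t : ℝ) : HasDerivAt y' (-(q t * y t)) t

namespace IsHillSolution

variable {q y y' z z' : ℝ → ℝ}

theorem of_deriv (hy : Differentiable ℝ y) (hy' : Differentiable ℝ (deriv y))
    (h : ∀ t, deriv (deriv y) t + q t * y t = 0) : IsHillSolution q y (deriv y) where
  hasDerivAt t := (hy t).hasDerivAt
  hasDerivAt_deriv t := by
    rw [← eq_neg_of_add_eq_zero_left (h t)]
    exact (hy' t).hasDerivAt

theorem deriv_eq (h : IsHillSolution q y y') : deriv y = y' :=
  funext fun t => (h.hasDerivAt t).deriv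

theorem differentiable (h : IsHillSolution q y y') : Differentiable ℝ y :=
  fun t => (h.hasDerivAt t).differentiableAt

theorem differentiable_deriv (h : IsHillSolution q y y') : Differentiable ℝ (deriv y) :=
  h.deriv_eq ▸ fun t => (h.hasDerivAt_deriv t).differentiableAt

theorem deriv_deriv_add (h : IsHillSolution q y y') (t : ℝ) :
    deriv (deriv y) t + q t * y t = 0 := by
  rw [h.deriv_eq, (h.hasDerivAt_deriv t).deriv, neg_add_cancel]

theorem const_mul (h : IsHillSolution q y y') (c : ℝ) :
    IsHillSolution q (fun t => c * y t) (fun t => c * y' t) where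
  hasDerivAt t := (h.hasDerivAt t).const_mul c
  hasDerivAt_deriv t := ((h.hasDerivAt_deriv t).const_mul c).congr_deriv (by ring)

theorem sub (hy : IsHillSolution q y y') (hz : IsHillSolution q z z') :
    IsHillSolution q (fun t => y t - z t) (fun t => y' t - z' t) where
  hasDerivAt t := (hy.hasDerivAt t).sub (hz.hasDerivAt t)
  hasDerivAt_deriv t :=
    ((hy.hasDerivAt_deriv t).sub (hz.hasDerivAt_deriv t)).congr_deriv (by ring)

theorem comp_add_const {p : ℝ} (h : IsHillSolution q y y') (hq : ∀ t, q (t + p) = q t) :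
    IsHillSolution q (fun t => y (t + p)) (fun t => y' (t + p)) where
  hasDerivAt t := (h.hasDerivAt (t + p)).comp_add_const t p
  hasDerivAt_deriv t := by
    simpa only [hq] using (h.hasDerivAt_deriv (t + p)).comp_add_const t p

theorem wronskian_eq (hy : IsHillSolution q y y') (hz : IsHillSolution q z z') (s t : ℝ) :
    y s * z' s - y' s * z s = y t * z' t - y' t * z t := by
  have hW (t : ℝ) : HasDerivAt (fun t => y t * z' t - y' t * z t) 0 t :=
    (((hy.hasDerivAt t).mul (hz.hasDerivAt_deriv t)).sub
      ((hy.hasDerivAt_deriv t).mul (hz.hasDerivAt t))).congr_deriv (by ring)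
  exact is_const_of_deriv_eq_zero (fun t => (hW t).differentiableAt) (fun t => (hW t).deriv) s t

/-- If Hill's equation has a positive solution, a solution with two zeros vanishes. -/
theorem eq_zero_of_pos (hy : IsHillSolution q y y') (hpos : ∀ t, 0 < y t)
    (hz : IsHillSolution q z z') {t₁ t₂ : ℝ} (hne : t₁ ≠ t₂) (h₁ : z t₁ = 0) (h₂ : z t₂ = 0)
    (t : ℝ) : z t = 0 := by
  wlog hlt : t₁ < t₂ generalizing t₁ t₂
  · exact this hne.symm h₂ h₁ (hne.lt_or_gt.resolve_left hlt)
  have hdiv (t : ℝ) : HasDerivAt (fun t => z t / y t) ((z' t * y t - z t * y' t) / y t ^ 2) t :=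
    (hz.hasDerivAt t).div (hy.hasDerivAt t) (hpos t).ne'
  obtain ⟨c, -, hc⟩ := exists_hasDerivAt_eq_zero hlt
    (fun t _ => (hdiv t).continuousAt.continuousWithinAt) (by simp [h₁, h₂]) fun t _ => hdiv t
  have hWc : z' c * y c - z c * y' c = 0 :=
    (div_eq_zero_iff.1 hc).resolve_right (pow_ne_zero 2 (hpos c).ne')
  have hW (t : ℝ) : z' t * y t - z t * y' t = 0 := by
    linarith [hy.wronskian_eq hz c t]
  have hconst : z t / y t = z t₁ / y t₁ :=
    is_const_of_deriv_eq_zero (fun t => (hdiv t).differentiableAt)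
      (fun t => by rw [(hdiv t).deriv, hW, zero_div]) t t₁
  rw [h₁, zero_div] at hconst
  exact (div_eq_zero_iff.1 hconst).resolve_right (ne_of_gt (hpos t))

/-- Hill's equation with bounded continuous coefficient has a solution with `y 0 = 0`,
`y' 0 = 1`. -/
theorem exists_sine (hq : Continuous q) {K : ℝ} (hK : ∀ t, ‖q t‖ ≤ K) :
    ∃ y y' : ℝ → ℝ, IsHillSolution q y y' ∧ y 0 = 0 ∧ y' 0 = 1 := by
  let B : ℝ × ℝ →L[ℝ] ℝ × ℝ := (ContinuousLinearMap.snd ℝ ℝ ℝ).prod 0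
  let C : ℝ × ℝ →L[ℝ] ℝ × ℝ := (0 : ℝ × ℝ →L[ℝ] ℝ).prod (-ContinuousLinearMap.fst ℝ ℝ ℝ)
  obtain ⟨x, hx0, hx⟩ := exists_hasDerivAt_linear (fun t => B + q t • C) (by fun_prop)
    (‖B‖ + K * ‖C‖) (fun t => (norm_add_le _ _).trans (by rw [norm_smul]; gcongr; exact hK t))
    ((0, 1) : ℝ × ℝ)
  refine ⟨fun t => (x t).1, fun t => (x t).2, ⟨fun t => ?_, fun t => ?_⟩, by simp [hx0],
    by simp [hx0]⟩
  · exact ((ContinuousLinearMap.fst ℝ ℝ ℝ).hasFDerivAt.comp_hasDerivAt t (hx t)).congr_deriv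
      (by simp [B, C])
  · exact ((ContinuousLinearMap.snd ℝ ℝ ℝ).hasFDerivAt.comp_hasDerivAt t (hx t)).congr_deriv
      (by simp [B, C])

/-- Three consecutive translates of a solution by a period satisfy a linear recurrence. -/
theorem exists_translate_eq {p : ℝ} (h : IsHillSolution q y y') (hq : ∀ t, q (t + p) = q t)
    (hy0 : y 0 = 0) (hy'0 : y' 0 ≠ 0) (hyp : y p ≠ 0) :
    ∃ T : ℝ, ∀ t, y (t + p + p) = T * y (t + p) - y t := by
  have h₁ := h.comp_add_const hq
  have h₂ := h₁.comp_add_const hq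
  have hc : y 0 * y' (0 + p) - y' 0 * y (0 + p) ≠ 0 := by simp [hy0, hy'0, hyp]
  refine ⟨(y 0 * y' (0 + p + p) - y' 0 * y (0 + p + p)) /
    (y 0 * y' (0 + p) - y' 0 * y (0 + p)), fun t => ?_⟩
  have e₁ := h.wronskian_eq h₁ 0 t
  have e₂ := h.wronskian_eq h₂ 0 t
  have e₃ := h.wronskian_eq h₁ 0 (t + p)
  rw [eq_sub_iff_add_eq, div_mul_eq_mul_div, eq_div_iff hc]
  linear_combination y (t + p + p) * e₁ - y (t + p) * e₂ + y t * e₃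

end IsHillSolution

/-- A solution of `a (n + 2) = T a (n + 1) - a n` which is positive for `n ≥ 1` does not
oscillate. -/
theorem two_le_of_recurrence_pos {a : ℕ → ℝ} {T : ℝ} (hpos : ∀ n, 0 < a (n + 1))
    (ha : ∀ n, a (n + 2) = T * a (n + 1) - a n) : 2 ≤ T := by
  by_contra! hT
  let r : ℕ → ℝ := fun n => a (n + 2) / a (n + 1)
  have hr (n : ℕ) : 0 < r n := div_pos (hpos (n + 1)) (hpos n)
  have hstep (n : ℕ) : r (n + 1) ≤ r n - (2 - T) := by
    have hrec : r (n + 1) = T - (r n)⁻¹ := by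
      have := (hpos n).ne'
      have := (hpos (n + 1)).ne'
      simp only [r, ha (n + 1)]
      field_simp
    have hsq : 2 ≤ r n + (r n)⁻¹ := by
      have := (hr n).ne'
      have : r n + (r n)⁻¹ - 2 = (r n - 1) ^ 2 * (r n)⁻¹ := by field_simp; ring
      nlinarith [mul_nonneg (sq_nonneg (r n - 1)) (inv_pos.2 (hr n)).le]
    linarith
  have hdecr (n : ℕ) : r n ≤ r 0 - n * (2 - T) := by
    induction n with
    | zero => simp
    | succ n ih => push_cast; linarith [hstep n]
  obtain ⟨n, hn⟩ := exists_nat_gt (r 0 / (2 - T))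
  rw [div_lt_iff₀ (by linarith)] at hn
  linarith [hr n, hdecr n]

/-- A continuous real function without zeros on a preconnected space has constant sign. -/
theorem mul_pos_of_forall_ne_zero {f : ℝ → ℝ} {s : Set ℝ} (hs : IsPreconnected s)
    (hf : ContinuousOn f s) (h : ∀ t ∈ s, f t ≠ 0) {a b : ℝ} (ha : a ∈ s) (hb : b ∈ s) :
    0 < f a * f b := by
  by_contra! hle
  have key : ∃ t ∈ s, f t = 0 := by
    rcases mul_nonpos_iff.1 hle with ⟨h₁, h₂⟩ | ⟨h₁, h₂⟩
    · exact hs.intermediate_value hb ha hf ⟨h₂, h₁⟩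
    · exact hs.intermediate_value ha hb hf ⟨h₁, h₂⟩
  obtain ⟨t, ht, ht0⟩ := key
  exact h t ht ht0

/-- Without conjugate points, Hill's equation with coefficient of period `p` has a positive
quasiperiodic solution. -/
theorem IsHillSolution.exists_pos_quasiperiodic {q : ℝ → ℝ} {p : ℝ} (hp : 0 < p)
    (hqc : Continuous q) (hq : ∀ t, q (t + p) = q t)
    (H : ∀ y y' : ℝ → ℝ, IsHillSolution q y y' →
      ∀ t₁ t₂, t₁ ≠ t₂ → y t₁ = 0 → y t₂ = 0 → ∀ t, y t = 0) :
    ∃ y y' : ℝ → ℝ, IsHillSolution q y y' ∧ (∀ t, 0 < y t) ∧ ∃ μ, ∀ t, y (t + p) = μ * y t := by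
  obtain ⟨K, hK⟩ : ∃ K, ∀ t, ‖q t‖ ≤ K := by
    obtain ⟨K, hK⟩ := (Function.Periodic.isBounded_of_continuous hq hp.ne' hqc).exists_norm_le
    exact ⟨K, fun t => hK _ ⟨t, rfl⟩⟩
  obtain ⟨S, S', hS, hS0, hS'0⟩ := exists_sine hqc hK
  have hS_ne (t : ℝ) (ht : t ≠ 0) : S t ≠ 0 := fun h => by
    have hzero : S = fun _ => 0 := funext (H S S' hS t 0 ht h hS0)
    have := (hS.hasDerivAt 0).deriv
    simp [hzero, hS'0] at this
  have hSp : S p ≠ 0 := hS_ne p hp.ne'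
  obtain ⟨T, hT⟩ := hS.exists_translate_eq hq hS0 (by simp [hS'0]) hSp
  have hT2 : 2 ≤ T := by
    refine two_le_of_recurrence_pos (a := fun n => S p * S (n * p)) (fun n => ?_) fun n => ?_
    · exact mul_pos_of_forall_ne_zero (s := Set.Ioi 0) isPreconnected_Ioi
        hS.differentiable.continuous.continuousOn (fun t ht => hS_ne t (ne_of_gt ht)) hp
        (Set.mem_Ioi.2 (by positivity))
    · have := hT (n * p)
      push_cast
      rw [show ((n : ℝ) + 2) * p = n * p + p + p by ring,
        show ((n : ℝ) + 1) * p = n * p + p by ring, this]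
      ring
  have hsqrt : √(T ^ 2 - 4) ^ 2 = T ^ 2 - 4 := Real.sq_sqrt (by nlinarith)
  let μ := (T + √(T ^ 2 - 4)) / 2
  let ν := (T - √(T ^ 2 - 4)) / 2
  have hsum : μ + ν = T := by simp only [μ, ν]; ring
  have hprod : μ * ν = 1 := by simp only [μ, ν]; linear_combination -hsqrt / 4
  have hy := (hS.comp_add_const hq).sub (hS.const_mul ν)
  set y : ℝ → ℝ := fun t => S (t + p) - ν * S t with hy_def
  have hquasi (t : ℝ) : y (t + p) = μ * y t := by
    simp only [hy_def, hT t]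
    linear_combination (-S (t + p)) * hsum + S t * hprod
  have hy0 : y 0 = S p := by simp [hy_def, hS0]
  have hy_ne (t : ℝ) : y t ≠ 0 := fun h =>
    hSp (hy0 ▸ H _ _ hy t (t + p) (by linarith) h (by rw [hquasi, h, mul_zero]) 0)
  have hsign (t : ℝ) : 0 < y 0 * y t :=
    mul_pos_of_forall_ne_zero isPreconnected_univ hy.differentiable.continuous.continuousOn
      (fun t _ => hy_ne t) (Set.mem_univ 0) (Set.mem_univ t)
  exact ⟨_, _, hy.const_mul (y 0), hsign, μ, fun t => by rw [hquasi]; ring⟩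


open Real

/-- E. Hopf's lemma (Lemma 2.15): the Hill equation `y'' + q y = 0` with
continuous π-periodic `q` has no conjugate points iff it admits a positive
π-quasiperiodic solution. -/
theorem stmt7 (q : ℝ → ℝ) (hqc : Continuous q) (hqper : ∀ t, q (t + π) = q t) :
    (∀ y : ℝ → ℝ, Differentiable ℝ y → Differentiable ℝ (deriv y) →
        (∀ t, deriv (deriv y) t + q t * y t = 0) →
        ∀ t₁ t₂, t₁ ≠ t₂ → y t₁ = 0 → y t₂ = 0 → ∀ t, y t = 0) ↔
    (∃ y : ℝ → ℝ, Differentiable ℝ y ∧ Differentiable ℝ (deriv y) ∧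
        (∀ t, deriv (deriv y) t + q t * y t = 0) ∧
        (∀ t, 0 < y t) ∧
        ∃ μ : ℝ, ∀ t, y (t + π) = μ * y t) := by
  constructor
  · intro H
    obtain ⟨y, y', hy, hpos, hμ⟩ := IsHillSolution.exists_pos_quasiperiodic Real.pi_pos hqc hqper
      fun y y' hy => H y hy.differentiable hy.differentiable_deriv hy.deriv_deriv_add
    exact ⟨y, hy.differentiable, hy.differentiable_deriv, hy.deriv_deriv_add, hpos, hμ⟩
  · rintro ⟨y, hy, hy', hy_eq, hpos, -⟩ z hz hz' hz_eq t₁ t₂ hne h₁ h₂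
    exact (IsHillSolution.of_deriv hy hy' hy_eq).eq_zero_of_pos hpos
      (IsHillSolution.of_deriv hz hz' hz_eq) hne h₁ h₂
end

section
/- Let γ, δ : ℝ → ℝ² be smooth curves with γ(t + π) = −γ(t) and δ(t + π) = −δ(t) for all t, satisfying [γ(t), γ'(t)] = 1 and [δ(t), δ'(t)] = 1 for all t, and [γ(t), δ(t)] = c for all t, where c ∈ ℝ. Let p(t) = [γ''(t), γ'(t)] (the centroaffine curvature, so γ'' = p·γ) and set P = −(1/π)·∫₀^π p(t) dt. If P > 0, then c² ≤ 1/P. -/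
open Real

theorem HasDerivAt.cdet {f g : ℝ → ℝ × ℝ} {f' g' : ℝ × ℝ} {t : ℝ}
    (hf : HasDerivAt f f' t) (hg : HasDerivAt g g' t) :
    HasDerivAt (fun s => cdet (f s) (g s)) (cdet f' (g t) + cdet (f t) g') t := by
  have hf₁ : HasDerivAt (fun s => (f s).1) f'.1 t :=
    (ContinuousLinearMap.fst ℝ ℝ ℝ).hasFDerivAt.comp_hasDerivAt t hf
  have hf₂ : HasDerivAt (fun s => (f s).2) f'.2 t :=
    (ContinuousLinearMap.snd ℝ ℝ ℝ).hasFDerivAt.comp_hasDerivAt t hf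
  have hg₁ : HasDerivAt (fun s => (g s).1) g'.1 t :=
    (ContinuousLinearMap.fst ℝ ℝ ℝ).hasFDerivAt.comp_hasDerivAt t hg
  have hg₂ : HasDerivAt (fun s => (g s).2) g'.2 t :=
    (ContinuousLinearMap.snd ℝ ℝ ℝ).hasFDerivAt.comp_hasDerivAt t hg
  have h := (hf₁.mul hg₂).sub (hf₂.mul hg₁)
  refine h.congr_deriv ?_
  simp only [_root_.cdet]
  ring

theorem Continuous.cdet {f g : ℝ → ℝ × ℝ} (hf : Continuous f) (hg : Continuous g) :
    Continuous (fun s => cdet (f s) (g s)) := by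
  unfold _root_.cdet
  fun_prop

/-- The Plücker relation between four plane vectors. -/
theorem cdet_mul_cdet (x y u v : ℝ × ℝ) :
    cdet x y * cdet u v = cdet u y * cdet x v - cdet u x * cdet y v := by
  simp only [cdet]
  ring

/-- The derivative of an antiperiodic curve is antiperiodic. -/
theorem deriv_add_eq_neg_of_antiperiodic {f : ℝ → ℝ × ℝ} {T : ℝ}
    (h : ∀ t, f (t + T) = -f t) (t : ℝ) : deriv f (t + T) = -deriv f t := by
  rw [← deriv_comp_add_const, funext h, deriv.fun_neg]

/-- Corollary 2.14 (centroaffine Menzin conjecture): if a π-anti-periodic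
centroaffine curve `γ` with curvature `p = [γ'', γ']` has `P = −(1/π)∫₀^π p > 0`
and admits a `c`-related π-anti-periodic centroaffine curve `δ`,
then `c² ≤ 1/P`. -/
theorem stmt8 (γ δ : ℝ → ℝ × ℝ)
    (hγ : ContDiff ℝ (⊤ : ℕ∞) γ) (hδ : ContDiff ℝ (⊤ : ℕ∞) δ)
    (hγa : ∀ t, γ (t + π) = -γ t) (hδa : ∀ t, δ (t + π) = -δ t)
    (hγW : ∀ t, cdet (γ t) (deriv γ t) = 1)
    (hδW : ∀ t, cdet (δ t) (deriv δ t) = 1)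
    (c : ℝ) (hrel : ∀ t, cdet (γ t) (δ t) = c)
    (p : ℝ → ℝ) (hp : ∀ t, p t = cdet (deriv (deriv γ) t) (deriv γ t))
    (P : ℝ) (hP : P = -(1 / π) * ∫ t in (0:ℝ)..π, p t)
    (hPpos : 0 < P) :
    c^2 ≤ 1 / P := by
  have hdγ : ∀ t, HasDerivAt γ (deriv γ t) t := fun t =>
    (hγ.differentiable (by simp) t).hasDerivAt
  have hdδ : ∀ t, HasDerivAt δ (deriv δ t) t := fun t =>
    (hδ.differentiable (by simp) t).hasDerivAt
  have hγ' : ContDiff ℝ (⊤ : ℕ∞) (deriv γ) := (contDiff_infty_iff_deriv.1 hγ).2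
  have hδ' : ContDiff ℝ (⊤ : ℕ∞) (deriv δ) := (contDiff_infty_iff_deriv.1 hδ).2
  have hγ'' : ContDiff ℝ (⊤ : ℕ∞) (deriv (deriv γ)) := (contDiff_infty_iff_deriv.1 hγ').2
  have hdγ' : ∀ t, HasDerivAt (deriv γ) (deriv (deriv γ) t) t := fun t =>
    (hγ'.differentiable (by simp) t).hasDerivAt
  have hpc : Continuous p := by
    rw [funext hp]
    exact hγ''.continuous.cdet hγ'.continuous
  set a : ℝ → ℝ := fun t => cdet (δ t) (deriv γ t) with ha
  have hac : Continuous a := hδ.continuous.cdet hγ'.continuous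
  set a' : ℝ → ℝ := fun t =>
    cdet (deriv δ t) (deriv γ t) + cdet (δ t) (deriv (deriv γ) t) with ha'
  have hda : ∀ t, HasDerivAt a (a' t) t := fun t => (hdδ t).cdet (hdγ' t)
  have ha'c : Continuous a' :=
    (hδ'.continuous.cdet hγ'.continuous).add (hδ.continuous.cdet hγ''.continuous)
  have hriccati : ∀ t, a t ^ 2 = 1 + c * a' t + c ^ 2 * p t := by
    intro t
    have h1 : cdet (deriv γ t) (deriv γ t) + cdet (γ t) (deriv (deriv γ) t) = 0 := by
      have h := (hdγ t).cdet (hdγ' t)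
      rw [funext hγW] at h
      exact h.unique (hasDerivAt_const t 1)
    have h2 : cdet (deriv γ t) (δ t) + cdet (γ t) (deriv δ t) = 0 := by
      have h := (hdγ t).cdet (hdδ t)
      rw [funext hrel] at h
      exact h.unique (hasDerivAt_const t c)
    have h3 := cdet_mul_cdet (δ t) (deriv δ t) (γ t) (deriv γ t)
    have h4 := cdet_mul_cdet (δ t) (deriv (deriv γ) t) (γ t) (deriv γ t)
    have h5 : cdet (deriv γ t) (deriv γ t) = 0 := by simp only [cdet]; ring
    have h6 : cdet (deriv γ t) (δ t) = -a t := by simp only [ha, cdet]; ring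
    have h7 : cdet (γ t) (deriv (deriv γ) t) = 0 := by linarith
    have h8 : cdet (γ t) (deriv δ t) = a t := by linarith
    rw [hδW, hγW, hrel, h8] at h3
    rw [hγW, hrel, h7, ← hp] at h4
    simp only [ha'] at h3 h4 ⊢
    linear_combination -h3 - c * h4
  have hper : a π = a 0 := by
    have h1 := hδa 0
    have h2 := deriv_add_eq_neg_of_antiperiodic hγa 0
    rw [zero_add] at h1 h2
    simp only [ha, h1, h2, cdet, Prod.fst_neg, Prod.snd_neg]
    ring
  have hint' : ∫ t in (0:ℝ)..π, a' t = 0 := by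
    rw [intervalIntegral.integral_eq_sub_of_hasDerivAt (fun t _ => hda t)
      (ha'c.intervalIntegrable _ _), hper, sub_self]
  have hint : ∫ t in (0:ℝ)..π, a t ^ 2 = π + c ^ 2 * ∫ t in (0:ℝ)..π, p t := by
    rw [funext hriccati, intervalIntegral.integral_add
      (Continuous.intervalIntegrable (by fun_prop) _ _)
      (Continuous.intervalIntegrable (by fun_prop) _ _), intervalIntegral.integral_add
      (Continuous.intervalIntegrable (by fun_prop) _ _)
      (Continuous.intervalIntegrable (by fun_prop) _ _),
      intervalIntegral.integral_const_mul, intervalIntegral.integral_const_mul, hint']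
    simp
  have hnonneg : 0 ≤ ∫ t in (0:ℝ)..π, a t ^ 2 :=
    intervalIntegral.integral_nonneg pi_pos.le fun t _ => sq_nonneg _
  have hI : ∫ t in (0:ℝ)..π, p t = -(π * P) := by
    rw [hP]
    field_simp
  rw [hint, hI] at hnonneg
  rw [le_div_iff₀ hPpos]
  refine le_of_mul_le_mul_left ?_ pi_pos
  linarith
end

section
/- Let α ∈ (0, π). There exist a smooth π-periodic function g : ℝ → ℝ and a constant C ∈ ℝ such that (1/2)·(g'(t) + g'(t + α))·sin α − (g(t + α) − g(t))·cos α = C for all t, with g NOT of the form g(t) = c₀ + c₁·cos(2t) + c₂·sin(2t) for constants c₀, c₁, c₂, if and only if α = π/2 or there exists an integer k ≥ 4 with k·sin α·cos(kα) = sin(kα)·cos α (i.e. tan(kα) = k·tan α). -/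
open Real

/-- The Fourier mode `exp (-2 i n t)`, of period `π`. -/
noncomputable def mode (n : ℤ) (t : ℝ) : ℂ := Complex.exp (-(2 * n * t) * Complex.I)

theorem mode_add (n : ℤ) (s t : ℝ) : mode n (s + t) = mode n s * mode n t := by
  rw [mode, mode, mode, ← Complex.exp_add]
  push_cast
  ring_nf

theorem mode_pi (n : ℤ) : mode n π = 1 := by
  rw [mode, Complex.exp_eq_one_iff]
  exact ⟨-n, by push_cast; ring⟩

theorem mode_zero (n : ℤ) : mode n 0 = 1 := by simp [mode]

theorem hasDerivAt_mode (n : ℤ) (t : ℝ) :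
    HasDerivAt (mode n) (-(2 * n * Complex.I) * mode n t) t := by
  have h : HasDerivAt (fun x : ℝ => -(2 * n * (x : ℂ)) * Complex.I)
      (-(2 * n * 1) * Complex.I) t :=
    (((Complex.ofRealCLM.hasDerivAt (x := t)).const_mul (2 * n : ℂ)).neg).mul_const _
  refine h.cexp.congr_deriv ?_
  rw [mode]
  ring

theorem continuous_mode (n : ℤ) : Continuous (mode n) :=
  continuous_iff_continuousAt.2 fun t => (hasDerivAt_mode n t).continuousAt

theorem mode_ne_zero (n : ℤ) (t : ℝ) : mode n t ≠ 0 := Complex.exp_ne_zero _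

theorem integral_mode_mul_shift (n : ℤ) (α : ℝ) {f : ℝ → ℝ} (hf : ∀ t, f (t + π) = f t) :
    mode n α * ∫ t in (0 : ℝ)..π, mode n t * f (t + α) = ∫ t in (0 : ℝ)..π, mode n t * f t := by
  have hper : Function.Periodic (fun t => mode n t * (f t : ℂ)) π := fun t => by
    simp only [mode_add, mode_pi, hf, mul_one]
  have h := hper.intervalIntegral_add_eq 0 α
  rw [zero_add] at h
  rw [h, ← intervalIntegral.integral_const_mul, add_comm α π]
  have h2 := intervalIntegral.integral_comp_add_right (a := 0) (b := π)
    (fun t => mode n t * (f t : ℂ)) α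
  rw [zero_add] at h2
  rw [← h2]
  refine intervalIntegral.integral_congr fun t _ => ?_
  simp only [mode_add]
  ring

theorem integral_mode_mul_deriv (n : ℤ) {g : ℝ → ℝ} (hg : ContDiff ℝ 1 g)
    (hper : ∀ t, g (t + π) = g t) :
    ∫ t in (0 : ℝ)..π, mode n t * ((deriv g t : ℝ) : ℂ) =
      2 * n * Complex.I * ∫ t in (0 : ℝ)..π, mode n t * g t := by
  have hd : Continuous (deriv g) := hg.continuous_deriv le_rfl
  have hm := continuous_mode n
  have hc := hg.continuous
  have hderiv : ∀ t ∈ Set.uIcc 0 π, HasDerivAt (fun t => mode n t * (g t : ℂ))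
      (-(2 * n * Complex.I) * mode n t * g t + mode n t * ((deriv g t : ℝ) : ℂ)) t := fun t _ =>
    (hasDerivAt_mode n t).mul ((hg.differentiable one_ne_zero t).hasDerivAt.ofReal_comp)
  have h := intervalIntegral.integral_eq_sub_of_hasDerivAt hderiv
    (Continuous.intervalIntegrable (by fun_prop) _ _)
  have h0 : g π = g 0 := by simpa using hper 0
  rw [intervalIntegral.integral_add (Continuous.intervalIntegrable (by fun_prop) _ _)
    (Continuous.intervalIntegrable (by fun_prop) _ _), mode_pi, mode_zero, h0, sub_self] at h
  simp only [mul_assoc (-(2 * n * Complex.I))] at h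
  rw [intervalIntegral.integral_const_mul] at h
  linear_combination h

theorem integral_mode {n : ℤ} (hn : n ≠ 0) : ∫ t in (0 : ℝ)..π, mode n t = 0 := by
  have h := integral_mode_mul_deriv n (g := fun _ => 1) contDiff_const fun _ => rfl
  simpa [hn] using h

/-- The condition under which the mode of index `n` solves the linearized equation. -/
def Resonant (α : ℝ) (n : ℤ) : Prop :=
  (n : ℝ) * Real.sin α * Real.cos (n * α) = Real.sin (n * α) * Real.cos α

theorem resonant_abs {α : ℝ} {n : ℤ} (h : Resonant α n) : Resonant α |n| := by
  rcases abs_choice n with hn | hn <;> rw [hn]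
  · exact h
  · unfold Resonant at *
    push_cast
    rw [neg_mul (n : ℝ) α, Real.cos_neg, Real.sin_neg]
    linarith

theorem Resonant.eq_pi_div_two_or_four_le {α : ℝ} (hα : α ∈ Set.Ioo 0 π) {n : ℤ} (hn : 2 ≤ n)
    (h : Resonant α n) : α = π / 2 ∨ 4 ≤ n := by
  have hs : Real.sin α ≠ 0 := (Real.sin_pos_of_pos_of_lt_pi hα.1 hα.2).ne'
  have hsc := Real.sin_sq_add_cos_sq α
  by_contra! hcon
  obtain ⟨hne, hlt⟩ := hcon
  have hc : Real.cos α ≠ 0 := fun hc => hne <|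
    Real.injOn_cos ⟨hα.1.le, hα.2.le⟩ ⟨by positivity, by linarith [Real.pi_pos]⟩
      (by rw [hc, Real.cos_pi_div_two])
  unfold Resonant at h
  obtain rfl | rfl : n = 2 ∨ n = 3 := by omega
  · push_cast at h
    rw [Real.cos_two_mul, Real.sin_two_mul] at h
    have : Real.sin α ^ 3 = 0 := by linear_combination -h / 2 + Real.sin α * hsc
    exact hs (pow_eq_zero_iff (by norm_num) |>.1 this)
  · push_cast at h
    rw [Real.cos_three_mul, Real.sin_three_mul] at h
    have : Real.sin α ^ 3 * Real.cos α = 0 := by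
      linear_combination -h / 8 + 3 / 2 * Real.sin α * Real.cos α * hsc
    exact mul_ne_zero (pow_ne_zero 3 hs) hc this

theorem resonant_of_integral_mode_ne_zero {α C : ℝ} {g : ℝ → ℝ} (hg : ContDiff ℝ 1 g)
    (hper : ∀ t, g (t + π) = g t)
    (heq : ∀ t, (1 / 2) * (deriv g t + deriv g (t + α)) * Real.sin α
      - (g (t + α) - g t) * Real.cos α = C)
    {n : ℤ} (hn : n ≠ 0) (ha : ∫ t in (0 : ℝ)..π, mode n t * g t ≠ 0) : Resonant α n := by
  have hd : Continuous (deriv g) := hg.continuous_deriv le_rfl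
  have hm := continuous_mode n
  have hc := hg.continuous
  have hdper : ∀ t, deriv g (t + π) = deriv g t := fun t => by
    rw [← deriv_comp_add_const, funext hper]
  have h1 := integral_mode_mul_shift n α hper
  have h2 := integral_mode_mul_shift n α hdper
  have h3 := integral_mode_mul_deriv n hg hper
  have hint : (1 / 2 : ℂ) * Real.sin α * ((∫ t in (0 : ℝ)..π, mode n t * ((deriv g t : ℝ) : ℂ)) +
      ∫ t in (0 : ℝ)..π, mode n t * ((deriv g (t + α) : ℝ) : ℂ)) -
      Real.cos α * ((∫ t in (0 : ℝ)..π, mode n t * g (t + α)) -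
      ∫ t in (0 : ℝ)..π, mode n t * g t) = 0 := by
    rw [← intervalIntegral.integral_add (Continuous.intervalIntegrable (by fun_prop) _ _)
      (Continuous.intervalIntegrable (by fun_prop) _ _),
      ← intervalIntegral.integral_sub (Continuous.intervalIntegrable (by fun_prop) _ _)
      (Continuous.intervalIntegrable (by fun_prop) _ _),
      ← intervalIntegral.integral_const_mul, ← intervalIntegral.integral_const_mul,
      ← intervalIntegral.integral_sub (Continuous.intervalIntegrable (by fun_prop) _ _)
      (Continuous.intervalIntegrable (by fun_prop) _ _)]
    trans ∫ t in (0 : ℝ)..π, (C : ℂ) * mode n t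
    · refine intervalIntegral.integral_congr fun t _ => ?_
      simp only [← heq t]
      push_cast
      ring
    · rw [intervalIntegral.integral_const_mul, integral_mode hn, mul_zero]
  set a := ∫ t in (0 : ℝ)..π, mode n t * g t
  set u := Complex.exp (-(n * α) * Complex.I) with hu
  set c := Complex.cos (n * α) with hc_def
  set s := Complex.sin (n * α) with hs_def
  have hmode : mode n α = u ^ 2 := by
    rw [mode, hu, ← Complex.exp_nat_mul]
    push_cast
    ring_nf
  have huc : u = c - s * Complex.I := by
    rw [hu, Complex.exp_mul_I, Complex.cos_neg, Complex.sin_neg]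
    ring
  have hcs : s ^ 2 + c ^ 2 = 1 := Complex.sin_sq_add_cos_sq _
  have hI := Complex.I_sq
  have hu0 : u ≠ 0 := Complex.exp_ne_zero _
  rw [hmode] at h1 h2
  have key : (2 * Complex.I * u * a) * (n * Real.sin α * c - s * Real.cos α) = 0 := by
    have e1 : u ^ 2 + 1 = 2 * u * c := by
      rw [huc]; linear_combination s ^ 2 * hI - hcs
    have e2 : 1 - u ^ 2 = 2 * u * s * Complex.I := by
      rw [huc]; linear_combination s ^ 2 * hI - hcs
    linear_combination u ^ 2 * hint - (1 / 2 : ℂ) * Real.sin α * (u ^ 2 * h3 + h2 + h3)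
      + Real.cos α * h1 - n * Complex.I * Real.sin α * a * e1 + Real.cos α * a * e2
  have hfin := (mul_eq_zero.1 key).resolve_left (by simp [hu0, ha])
  rw [hc_def, hs_def] at hfin
  unfold Resonant
  exact_mod_cast sub_eq_zero.1 hfin

theorem exists_trig_of_integral_mode_eq_zero {g : ℝ → ℝ} (hg : Continuous g)
    (hper : ∀ t, g (t + π) = g t)
    (ha : ∀ n : ℤ, 2 ≤ |n| → ∫ t in (0 : ℝ)..π, mode n t * g t = 0) :
    ∃ c₀ c₁ c₂ : ℝ, ∀ t, g t = c₀ + c₁ * Real.cos (2 * t) + c₂ * Real.sin (2 * t) := by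
  have : Fact (0 < π) := ⟨Real.pi_pos⟩
  have hper' : Function.Periodic (fun t => (g t : ℂ)) π := fun t => by simp only [hper]
  let G : C(AddCircle π, ℂ) := ⟨hper'.lift, by
    exact continuous_coinduced_dom.2 (Complex.continuous_ofReal.comp hg)⟩
  have hG : ∀ t : ℝ, G (t : AddCircle π) = g t := fun t => hper'.lift_coe t
  have hcoef : ∀ n : ℤ, n ∉ ({0, 1, -1} : Finset ℤ) → fourierCoeff G n = 0 := fun n hn => by
    have hn2 : 2 ≤ |n| := by
      simp only [Finset.mem_insert, Finset.mem_singleton, not_or] at hn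
      rw [le_abs]
      omega
    rw [fourierCoeff_eq_intervalIntegral _ _ 0, zero_add]
    convert smul_zero _
    rw [← ha n hn2]
    refine intervalIntegral.integral_congr fun t _ => ?_
    simp only [fourier_coe_apply, hG, mode, smul_eq_mul]
    congr 2
    have := Complex.ofReal_ne_zero.2 Real.pi_ne_zero
    push_cast
    field_simp
  have hsum : Summable (fourierCoeff G) :=
    summable_of_ne_finset_zero (s := {0, 1, -1}) hcoef
  refine ⟨(fourierCoeff G 0).re, (fourierCoeff G 1).re + (fourierCoeff G (-1)).re,
    (fourierCoeff G (-1)).im - (fourierCoeff G 1).im, fun t => ?_⟩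
  have h1 := has_pointwise_sum_fourier_series_of_summable hsum (t : AddCircle π)
  have h2 := h1.unique (hasSum_sum_of_ne_finset_zero (s := {0, 1, -1})
    fun n hn => by rw [hcoef n hn, zero_smul])
  have hexp : ∀ n : ℤ, fourier n (t : AddCircle π) =
      Complex.exp (((n * (2 * t) : ℝ) : ℂ) * Complex.I) := fun n => by
    rw [fourier_coe_apply]
    have := Complex.ofReal_ne_zero.2 Real.pi_ne_zero
    congr 1
    push_cast
    field_simp
  rw [hG, Finset.sum_insert (by decide), Finset.sum_insert (by decide),
    Finset.sum_singleton, hexp, hexp, hexp] at h2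
  have h3 := congrArg Complex.re h2
  simp only [Complex.add_re, smul_eq_mul, Complex.mul_re, Complex.exp_ofReal_mul_I_re,
    Complex.exp_ofReal_mul_I_im, Complex.ofReal_re] at h3
  rw [h3]
  simp
  ring

theorem exists_nontrivial_of_resonant {α : ℝ} {k : ℤ} (hk : 2 ≤ k) (h : Resonant α k) :
    ∃ (g : ℝ → ℝ) (C : ℝ), ContDiff ℝ (⊤ : ℕ∞) g ∧ (∀ t, g (t + π) = g t) ∧
      (∀ t, (1/2) * (deriv g t + deriv g (t + α)) * Real.sin α
        - (g (t + α) - g t) * Real.cos α = C) ∧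
      ¬ ∃ c₀ c₁ c₂ : ℝ, ∀ t,
        g t = c₀ + c₁ * Real.cos (2 * t) + c₂ * Real.sin (2 * t) := by
  have hkR : (2 : ℝ) ≤ k := by exact_mod_cast hk
  have hk0 : (k : ℝ) ≠ 0 := by linarith
  have hder : ∀ t : ℝ, deriv (fun t : ℝ => Real.cos (2 * k * t)) t =
      -(2 * k * Real.sin (2 * k * t)) := fun t => by
    have := ((hasDerivAt_id t).const_mul (2 * k : ℝ)).cos
    refine HasDerivAt.deriv (this.congr_deriv ?_)
    simp only [id]
    ring
  refine ⟨fun t => Real.cos (2 * k * t), 0, by fun_prop, fun t => ?_, fun t => ?_, ?_⟩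
  · beta_reduce
    rw [show 2 * (k : ℝ) * (t + π) = 2 * k * t + k * (2 * π) by ring,
      Real.cos_add_int_mul_two_pi]
  · simp only [hder]
    obtain ⟨m, hm⟩ : ∃ m, m = 2 * (k : ℝ) * t + k * α := ⟨_, rfl⟩
    rw [show 2 * (k : ℝ) * (t + α) = m + k * α by rw [hm]; ring,
      show 2 * (k : ℝ) * t = m - k * α by rw [hm]; ring,
      Real.sin_add, Real.sin_sub, Real.cos_add, Real.cos_sub]
    unfold Resonant at h
    linear_combination -2 * Real.sin m * h
  · rintro ⟨c₀, c₁, c₂, hc⟩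
    beta_reduce at hc
    have hs : Real.sin (π / k) ≠ 0 := by
      refine (Real.sin_pos_of_pos_of_lt_pi (div_pos Real.pi_pos (by linarith)) ?_).ne'
      exact div_lt_self Real.pi_pos (by linarith)
    have hrot : ∀ m, c₁ * Real.sin m - c₂ * Real.cos m = 0 := fun m => by
      have h1 := hc ((m + π / k) / 2)
      have h2 := hc ((m - π / k) / 2)
      rw [show 2 * (k : ℝ) * ((m + π / k) / 2) = 2 * k * ((m - π / k) / 2) + 2 * π by
        field_simp; ring, Real.cos_add_two_pi, h2,
        show 2 * ((m + π / k) / 2) = m + π / k by ring,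
        show 2 * ((m - π / k) / 2) = m - π / k by ring,
        Real.sin_add, Real.sin_sub, Real.cos_add, Real.cos_sub] at h1
      refine (mul_eq_zero.1 (?_ : Real.sin (π / k) * _ = 0)).resolve_left hs
      linear_combination h1 / 2
    have hc2 : c₂ = 0 := by simpa using hrot 0
    have hc1 : c₁ = 0 := by simpa using hrot (π / 2)
    have h0 := hc 0
    have h1 := hc (π / (2 * k))
    rw [show 2 * (k : ℝ) * (π / (2 * k)) = π by field_simp, Real.cos_pi, hc1, hc2] at h1
    simp only [mul_zero, Real.cos_zero, hc1, hc2] at h0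
    linarith


/-- Theorem 3.1: a non-trivial infinitesimal deformation of the unit circle in
the class of self-Bäcklund centroaffine curves with rotation number `α`
exists iff either `α = π/2` or `tan(kα) = k tan α` for some integer `k ≥ 4`. -/
theorem stmt9 (α : ℝ) (hα : α ∈ Set.Ioo 0 π) :
    (∃ (g : ℝ → ℝ) (C : ℝ), ContDiff ℝ (⊤ : ℕ∞) g ∧ (∀ t, g (t + π) = g t) ∧
        (∀ t, (1/2) * (deriv g t + deriv g (t + α)) * Real.sin α
            - (g (t + α) - g t) * Real.cos α = C) ∧
        ¬ ∃ c₀ c₁ c₂ : ℝ, ∀ t,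
            g t = c₀ + c₁ * Real.cos (2 * t) + c₂ * Real.sin (2 * t)) ↔
    (α = π / 2 ∨ ∃ k : ℤ, 4 ≤ k ∧
        (k : ℝ) * Real.sin α * Real.cos (k * α)
          = Real.sin (k * α) * Real.cos α) := by
  constructor
  · rintro ⟨g, C, hg, hper, heq, hnt⟩
    by_contra hcon
    have hg1 : ContDiff ℝ 1 g := hg.of_le (by exact_mod_cast le_top)
    refine hnt (exists_trig_of_integral_mode_eq_zero hg.continuous hper fun n hn => ?_)
    by_contra ha
    have hn0 : n ≠ 0 := by
      rintro rfl
      simp at hn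
    have hres := resonant_abs (resonant_of_integral_mode_ne_zero hg1 hper heq hn0 ha)
    exact hcon ((hres.eq_pi_div_two_or_four_le hα hn).imp_right fun h4 => ⟨|n|, h4, hres⟩)
  · rintro (rfl | ⟨k, hk, h⟩)
    · refine exists_nontrivial_of_resonant (k := 3) (by norm_num) ?_
      unfold Resonant
      push_cast
      rw [Real.cos_three_mul, Real.cos_pi_div_two]
      ring
    · exact exists_nontrivial_of_resonant (by omega) h
end

section
/- For every integer k ≥ 2, the set { α ∈ (0, π) : k·sin α·cos(kα) = sin(kα)·cos α } has exactly k − 2 elements. (This set is the solution set in (0, π) of the equation tan(kα) = k·tan α, where α = π/2 is counted as a solution exactly when k is odd.) -/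
open Real

/-- The difference of the two sides of `k sin x cos(kx) = sin(kx) cos x`. -/
noncomputable def tanDefect (k : ℕ) (x : ℝ) : ℝ :=
  (k : ℝ) * Real.sin x * Real.cos (k * x) - Real.sin (k * x) * Real.cos x

lemma hasDerivAt_tanDefect (k : ℕ) (x : ℝ) :
    HasDerivAt (tanDefect k) ((1 - (k : ℝ) ^ 2) * Real.sin x * Real.sin (k * x)) x := by
  have hl : HasDerivAt (fun y : ℝ => (k : ℝ) * y) k x := by
    simpa using (hasDerivAt_id x).const_mul (k : ℝ)
  have h := (((Real.hasDerivAt_sin x).const_mul (k : ℝ)).mul hl.cos).sub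
    (hl.sin.mul (Real.hasDerivAt_cos x))
  refine h.congr_deriv ?_
  ring

lemma continuous_tanDefect (k : ℕ) : Continuous (tanDefect k) := by
  unfold tanDefect
  fun_prop

lemma tanDefect_node {k : ℕ} (hk : k ≠ 0) (j : ℕ) :
    tanDefect k (j * π / k) = (-1) ^ j * (k * Real.sin (j * π / k)) := by
  have h : (k : ℝ) * (j * π / k) = j * π := by field_simp
  rw [tanDefect, h, Real.sin_nat_mul_pi, Real.cos_nat_mul_pi]
  ring

/-- Up to the sign `(-1) ^ j`, the defect is strictly decreasing between consecutive zeros of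
`sin (k x)`. -/
lemma strictAntiOn_tanDefect {k : ℕ} (hk : 2 ≤ k) {j : ℕ} (hj : j < k) :
    StrictAntiOn (fun x => (-1 : ℝ) ^ j * tanDefect k x)
      (Set.Icc (j * π / k) ((j + 1 : ℕ) * π / k)) := by
  have hk2 : (2 : ℝ) ≤ k := by exact_mod_cast hk
  have hk0 : (0 : ℝ) < k := by linarith
  refine strictAntiOn_of_deriv_neg (convex_Icc _ _)
    (continuous_const.mul (continuous_tanDefect k)).continuousOn fun x hx => ?_
  rw [interior_Icc, Set.mem_Ioo, div_lt_iff₀ hk0, lt_div_iff₀ hk0] at hx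
  obtain ⟨h1, h2⟩ := hx
  rw [((hasDerivAt_tanDefect k x).const_mul ((-1 : ℝ) ^ j)).deriv]
  have hjk : ((j + 1 : ℕ) : ℝ) ≤ k := by exact_mod_cast hj
  have hx0 : 0 < x := by
    have : 0 ≤ (j : ℝ) * π := by positivity
    exact pos_of_mul_pos_left (this.trans_lt h1) hk0.le
  have hxπ : x < π := by
    have : x * k < π * k := by nlinarith [Real.pi_pos]
    exact lt_of_mul_lt_mul_right this hk0.le
  have hsin := Real.sin_pos_of_pos_of_lt_pi hx0 hxπ
  have hsink : 0 < (-1 : ℝ) ^ j * Real.sin (k * x) := by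
    rw [← Real.sin_sub_nat_mul_pi]
    push_cast at h2
    exact Real.sin_pos_of_pos_of_lt_pi (by linarith) (by linarith)
  have hneg : 1 - (k : ℝ) ^ 2 < 0 := by nlinarith
  calc (-1 : ℝ) ^ j * ((1 - (k : ℝ) ^ 2) * Real.sin x * Real.sin (k * x))
      = (1 - (k : ℝ) ^ 2) * (Real.sin x * ((-1 : ℝ) ^ j * Real.sin (k * x))) := by ring
    _ < 0 := mul_neg_of_neg_of_pos hneg (mul_pos hsin hsink)

lemma sin_node_pos {k j : ℕ} (hj : 0 < j) (hjk : j < k) : 0 < Real.sin (j * π / k) := by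
  have hj' : (0 : ℝ) < j := by exact_mod_cast hj
  have hjk' : (j : ℝ) < k := by exact_mod_cast hjk
  have hk0 : (0 : ℝ) < k := hj'.trans hjk'
  refine Real.sin_pos_of_pos_of_lt_pi (by positivity) ?_
  rw [div_lt_iff₀ hk0]
  nlinarith [Real.pi_pos]

lemma neg_one_pow_mul_tanDefect_left {k : ℕ} (hk : k ≠ 0) (j : ℕ) :
    (-1 : ℝ) ^ j * tanDefect k (j * π / k) = k * Real.sin (j * π / k) := by
  rw [tanDefect_node hk, ← mul_assoc, ← mul_pow]
  simp

lemma neg_one_pow_mul_tanDefect_right {k : ℕ} (hk : k ≠ 0) (j : ℕ) :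
    (-1 : ℝ) ^ j * tanDefect k ((j + 1 : ℕ) * π / k) =
      -(k * Real.sin ((j + 1 : ℕ) * π / k)) := by
  rw [tanDefect_node hk, pow_succ, mul_neg_one, neg_mul, mul_neg, ← mul_assoc, ← mul_pow]
  simp

lemma exists_tanDefect_eq_zero {k j : ℕ} (hj : 0 < j) (hjk : j + 1 < k) :
    ∃ x ∈ Set.Ioo (j * π / k) ((j + 1 : ℕ) * π / k), tanDefect k x = 0 := by
  have hk : k ≠ 0 := by omega
  have hk0 : (0 : ℝ) < k := by exact_mod_cast Nat.pos_of_ne_zero hk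
  have hle : (j : ℝ) * π / k ≤ (j + 1 : ℕ) * π / k := by
    gcongr
    omega
  have hcont : Continuous fun x => (-1 : ℝ) ^ j * tanDefect k x :=
    continuous_const.mul (continuous_tanDefect k)
  obtain ⟨x, hx, hx0⟩ := intermediate_value_Ioo' hle hcont.continuousOn
    (show (0 : ℝ) ∈ _ by
      rw [Set.mem_Ioo, neg_one_pow_mul_tanDefect_left hk, neg_one_pow_mul_tanDefect_right hk]
      exact ⟨neg_neg_of_pos (mul_pos hk0 (sin_node_pos j.succ_pos hjk)),
        mul_pos hk0 (sin_node_pos hj (by omega))⟩)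
  exact ⟨x, hx, by simpa using hx0⟩

/-- A zero of the defect in `(0, π)` lies neither in the first nor in the last cell of the
subdivision by the zeros of `sin (k x)`. -/
lemma exists_cell_of_tanDefect_eq_zero {k : ℕ} (hk : 2 ≤ k) {x : ℝ} (hx : x ∈ Set.Ioo 0 π)
    (hx0 : tanDefect k x = 0) :
    ∃ j : ℕ, 0 < j ∧ j + 1 < k ∧ x ∈ Set.Icc (j * π / k) ((j + 1 : ℕ) * π / k) := by
  have hk0' : k ≠ 0 := by omega
  have hk0 : (0 : ℝ) < k := by exact_mod_cast Nat.pos_of_ne_zero hk0'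
  obtain ⟨hpos, hlt⟩ := hx
  have hnn : 0 ≤ x * k / π := by positivity
  set j := ⌊x * k / π⌋₊ with hj
  have h1 : (j : ℝ) * π / k ≤ x := by
    rw [div_le_iff₀ hk0, ← le_div_iff₀ Real.pi_pos]
    exact Nat.floor_le hnn
  have h2 : x < (j + 1 : ℕ) * π / k := by
    rw [lt_div_iff₀ hk0, ← div_lt_iff₀ Real.pi_pos]
    exact_mod_cast Nat.lt_floor_add_one (x * k / π)
  have hjk : j < k := by
    rw [hj, Nat.floor_lt hnn, div_lt_iff₀ Real.pi_pos]
    nlinarith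
  have hanti := strictAntiOn_tanDefect hk hjk
  have hmem : x ∈ Set.Icc (j * π / k) ((j + 1 : ℕ) * π / k) := ⟨h1, h2.le⟩
  refine ⟨j, Nat.pos_of_ne_zero fun h0 => ?_, lt_of_le_of_ne hjk fun h0 => ?_, hmem⟩
  · have hl : (j : ℝ) * π / k = 0 := by simp [h0]
    have := hanti (Set.left_mem_Icc.2 (h1.trans h2.le)) hmem (by rw [hl]; exact hpos)
    beta_reduce at this
    rw [neg_one_pow_mul_tanDefect_left hk0', hx0, hl] at this
    simp at this
  · have hr : ((j + 1 : ℕ) : ℝ) * π / k = π := by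
      rw [show j + 1 = k from h0]
      field_simp
    have := hanti hmem (Set.right_mem_Icc.2 (h1.trans h2.le)) h2
    beta_reduce at this
    rw [neg_one_pow_mul_tanDefect_right hk0', hx0, hr] at this
    simp at this

/-- Theorem 3.1(2): for every integer `k ≥ 2`, the equation
`k sin α cos(kα) = sin(kα) cos α` (the pole-free form of `tan(kα) = k tan α`)
has exactly `k − 2` solutions in the interval `(0, π)`. -/
theorem stmt10 (k : ℕ) (hk : 2 ≤ k) :
    letI S : Set ℝ := {α | α ∈ Set.Ioo 0 π ∧
      (k : ℝ) * Real.sin α * Real.cos (k * α) = Real.sin (k * α) * Real.cos α}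
    S.Finite ∧ S.ncard = k - 2 := by
  have hk0 : (0 : ℝ) < k := by exact_mod_cast (by omega : 0 < k)
  have hroot (j : ℕ) (h : j ∈ Set.Ioo 0 (k - 1)) :
      ∃ x ∈ Set.Ioo (j * π / k) ((j + 1 : ℕ) * π / k), tanDefect k x = 0 :=
    exists_tanDefect_eq_zero h.1 (by have := h.2; omega)
  choose! g hg hg0 using hroot
  have hinj : StrictMonoOn g (Set.Ioo 0 (k - 1)) := fun i hi j hj hij => by
    refine (hg i hi).2.trans (lt_of_le_of_lt ?_ (hg j hj).1)
    gcongr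
    exact hij
  have hS : {α : ℝ | α ∈ Set.Ioo 0 π ∧
      (k : ℝ) * Real.sin α * Real.cos (k * α) = Real.sin (k * α) * Real.cos α} =
      g '' Set.Ioo 0 (k - 1) := by
    ext x
    constructor
    · rintro ⟨hx, hx0⟩
      have hx0' : tanDefect k x = 0 := sub_eq_zero.2 hx0
      obtain ⟨j, hj, hjk, hmem⟩ := exists_cell_of_tanDefect_eq_zero hk hx hx0'
      have hj' : j ∈ Set.Ioo 0 (k - 1) := ⟨hj, by omega⟩
      refine ⟨j, hj', (strictAntiOn_tanDefect hk (by omega : j < k)).injOn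
        (Set.Ioo_subset_Icc_self (hg j hj')) hmem ?_⟩
      simp only [hg0 j hj', hx0']
    · rintro ⟨j, hj, rfl⟩
      refine ⟨⟨lt_of_le_of_lt (by positivity) (hg j hj).1, (hg j hj).2.trans_le ?_⟩,
        sub_eq_zero.1 (hg0 j hj)⟩
      have hjk : ((j + 1 : ℕ) : ℝ) ≤ k := by
        have := hj.2
        exact_mod_cast (by omega : j + 1 ≤ k)
      rw [div_le_iff₀ hk0, mul_comm π]
      gcongr
  rw [hS]
  refine ⟨(Set.finite_Ioo _ _).image g, ?_⟩
  rw [hinj.injOn.ncard_image, ← Finset.coe_Ioo, Set.ncard_coe_finset, Nat.card_Ioo]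
  omega
end

section
/- Let P₁, P₂, V₁, V₂ ∈ ℝ² with [P₁, P₂] = c ≠ 0. Then the three equations [P₁, V₁] = 1, [P₂, V₂] = 1, and [V₁, P₂] + [P₁, V₂] = 0 hold if and only if there exists f ∈ ℝ such that V₁ = f·P₁ + (1/c)·P₂ and V₂ = −(1/c)·P₁ − f·P₂. -/
open Real

/-- Lemma 3.5: for a parallelogram with vertices `±P₁, ±P₂` and `[P₁, P₂] = c ≠ 0`,
the velocities `V₁, V₂` satisfy `[P₁,V₁] = [P₂,V₂] = 1` and
`[V₁,P₂] + [P₁,V₂] = 0` iff `V₁ = f P₁ + (1/c) P₂` and `V₂ = −(1/c) P₁ − f P₂`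
for some `f ∈ ℝ`. -/
theorem stmt12 (P₁ P₂ V₁ V₂ : ℝ × ℝ) (c : ℝ) (hc : c ≠ 0)
    (hP : cdet P₁ P₂ = c) :
    (cdet P₁ V₁ = 1 ∧ cdet P₂ V₂ = 1 ∧ cdet V₁ P₂ + cdet P₁ V₂ = 0) ↔
    (∃ f : ℝ, V₁ = f • P₁ + (1 / c) • P₂ ∧ V₂ = -(1 / c) • P₁ - f • P₂) := by
  obtain ⟨a, b⟩ := P₁
  obtain ⟨p, q⟩ := P₂
  obtain ⟨x, y⟩ := V₁
  obtain ⟨z, w⟩ := V₂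
  simp only [cdet, Prod.smul_mk, Prod.mk_add_mk, Prod.mk_sub_mk, Prod.mk.injEq,
    smul_eq_mul] at *
  constructor
  · rintro ⟨h1, h2, h3⟩
    refine ⟨(x * q - y * p) / c, ⟨?_, ?_⟩, ?_, ?_⟩ <;> field_simp
    · linear_combination p * h1 - x * hP
    · linear_combination q * h1 - y * hP
    · linear_combination -a * h2 + p * h3 - z * hP
    · linear_combination -b * h2 + q * h3 - w * hP
  · rintro ⟨f, ⟨rfl, rfl⟩, rfl, rfl⟩
    refine ⟨?_, ?_, ?_⟩ <;> field_simp
    · linear_combination hP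
    · linear_combination hP
    · ring
end

section
/- Let n ≥ 3 be an odd integer and let P : ℤ → ℝ² satisfy P_{i+n} = −P_i and [P_i, P_{i+1}] = 1 for all i ∈ ℤ. Define a_i = [P_{i−1}, P_{i+1}] (so that P_{i+1} = a_i·P_i − P_{i−1} and a_{i+n} = a_i). Suppose V : ℤ → ℝ² satisfies V_{i+n} = −V_i, [P_i, V_i] = 1, and [V_i, P_{i+1}] + [P_i, V_{i+1}] = 0 for all i. Then for every i: V_i = (1/2)·( Σ_{j=0}^{n−1} (−1)^j · a_{i+j} )·P_i − P_{i−1}. -/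
open Real

/-- Expansion of a vector in a unimodular basis `p, q`, given its `p`-coordinate `-1`. -/
theorem eq_cdet_smul_sub {p q v : ℝ × ℝ} (hpq : cdet p q = 1) (hqv : cdet q v = 1) :
    v = cdet p v • q - p := by
  simp only [cdet] at *
  ext
  · simp only [Prod.fst_sub, Prod.smul_fst, smul_eq_mul]
    linear_combination -v.1 * hpq - p.1 * hqv
  · simp only [Prod.snd_sub, Prod.smul_snd, smul_eq_mul]
    linear_combination -v.2 * hpq - p.2 * hqv

/-- An alternating sum of sums of neighbours telescopes. -/
theorem sum_range_neg_one_pow_mul_add_succ (c : ℤ → ℝ) (i : ℤ) (m : ℕ) :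
    ∑ j ∈ Finset.range m, (-1 : ℝ) ^ j * (c (i + j) + c (i + j + 1))
      = c i - (-1) ^ m * c (i + m) := by
  induction m with
  | zero => simp
  | succ m ih =>
    rw [Finset.sum_range_succ, ih]
    push_cast
    rw [← add_assoc]
    ring

/-- Lemma 3.6: for a centroaffine `2n`-gon (`n` odd) with discrete Hill
coefficients `aᵢ = [P_{i−1}, P_{i+1}]`, the carrousel vector field `V`,
characterized by `[Pᵢ, Vᵢ] = 1` and `[Vᵢ, P_{i+1}] + [Pᵢ, V_{i+1}] = 0`,
is given by `Vᵢ = ½(aᵢ − a_{i+1} + ⋯ + a_{i+n−1}) Pᵢ − P_{i−1}`. -/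
theorem stmt13 (n : ℕ) (hn : 3 ≤ n) (hodd : Odd n)
    (P : ℤ → ℝ × ℝ)
    (hPa : ∀ i : ℤ, P (i + n) = -P i)
    (hPW : ∀ i : ℤ, cdet (P i) (P (i + 1)) = 1)
    (a : ℤ → ℝ) (ha : ∀ i : ℤ, a i = cdet (P (i - 1)) (P (i + 1)))
    (V : ℤ → ℝ × ℝ)
    (hVa : ∀ i : ℤ, V (i + n) = -V i)
    (hV1 : ∀ i : ℤ, cdet (P i) (V i) = 1)
    (hV2 : ∀ i : ℤ, cdet (V i) (P (i + 1)) + cdet (P i) (V (i + 1)) = 0) :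
    ∀ i : ℤ, V i
      = ((1/2 : ℝ) * ∑ j ∈ Finset.range n, (-1 : ℝ) ^ j * a (i + j)) • P i
        - P (i - 1) := by
  have hPW' (i : ℤ) : cdet (P (i - 1)) (P i) = 1 := by simpa using hPW (i - 1)
  set c : ℤ → ℝ := fun i => cdet (P (i - 1)) (V i) with hc
  have hV (i : ℤ) : V i = c i • P i - P (i - 1) := eq_cdet_smul_sub (hPW' i) (hV1 i)
  have hac (i : ℤ) : a i = c i + c (i + 1) := by
    have hsucc : c (i + 1) = cdet (P i) (V (i + 1)) := by simp [hc]
    have h2 := hV2 i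
    have h1 := hPW i
    rw [← hsucc, hV i] at h2
    rw [ha]
    simp only [cdet, Prod.fst_sub, Prod.snd_sub, Prod.smul_fst, Prod.smul_snd,
      smul_eq_mul] at h1 h2 ⊢
    linear_combination c i * h1 - h2
  have hcn (i : ℤ) : c (i + n) = c i := by
    simp only [hc, add_sub_right_comm, hPa, hVa]
    simp [cdet]
  intro i
  simp only [hac]
  rw [sum_range_neg_one_pow_mul_add_succ, hodd.neg_one_pow, hcn]
  convert hV i using 3
  ring
end

section
/- (Bianchi permutability.) Let γ, δ, Γ : ℝ → ℝ² be smooth curves with [γ, γ'] = [δ, δ'] = [Γ, Γ'] = 1 everywhere, and let b ≠ 0, c ≠ 0 be constants with [γ(t), δ(t)] = c and [γ(t), Γ(t)] = b for all t. Assume [Γ(t), δ(t)] ≠ 0 for all t, and define Δ(t) = ( c·δ(t) − b·Γ(t) ) / [Γ(t), δ(t)]. Then for all t: [Δ(t), Δ'(t)] = 1, [δ(t), Δ(t)] = b, and [Γ(t), Δ(t)] = c. In particular Δ is a centroaffine curve that is b-related to δ and c-related to Γ, and for each t the quadrilateral δ(t), γ(t), Γ(t), Δ(t) is a centroaffine butterfly.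 -/
open Real

/-- Leibniz rule for the determinant of two plane curves. -/
theorem hasDerivAt_cdet {u v : ℝ → ℝ × ℝ} {u' v' : ℝ × ℝ} {t : ℝ}
    (hu : HasDerivAt u u' t) (hv : HasDerivAt v v' t) :
    HasDerivAt (fun s => cdet (u s) (v s))
      (cdet u' (v t) + cdet (u t) v') t := by
  have hu₁ := (hasFDerivAt_fst (𝕜 := ℝ) (p := u t)).comp_hasDerivAt t hu
  have hu₂ := (hasFDerivAt_snd (𝕜 := ℝ) (p := u t)).comp_hasDerivAt t hu
  have hv₁ := (hasFDerivAt_fst (𝕜 := ℝ) (p := v t)).comp_hasDerivAt t hv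
  have hv₂ := (hasFDerivAt_snd (𝕜 := ℝ) (p := v t)).comp_hasDerivAt t hv
  refine ((hu₁.mul hv₂).sub (hu₂.mul hv₁)).congr_deriv ?_
  simp only [cdet, Function.comp_apply, ContinuousLinearMap.coe_fst',
    ContinuousLinearMap.coe_snd']
  ring

/-- Expansion of a determinant in a unimodular basis `p, q`. -/
theorem cdet_eq_of_cdet_eq_one {p q : ℝ × ℝ} (h : cdet p q = 1) (u v : ℝ × ℝ) :
    cdet u v = cdet u q * cdet p v - cdet p u * cdet v q := by
  rw [← mul_one (cdet u v), ← h]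
  simp only [cdet]
  ring

/-- The determinant of `f • w` and its derivative does not involve the derivative of `f`. -/
theorem cdet_smul_smul_add (r r' : ℝ) (w w' : ℝ × ℝ) :
    cdet (r • w) (r • w' + r' • w) = r ^ 2 * cdet w w' := by
  simp only [cdet, Prod.smul_fst, Prod.smul_snd, Prod.fst_add, Prod.snd_add, smul_eq_mul]
  ring

/-- If `[γ, δ]` is constant, then `[γ, δ'] = [δ, γ']`. -/
theorem cdet_deriv_eq_of_cdet_const {γ δ : ℝ → ℝ × ℝ} {c t : ℝ}
    (hγ : DifferentiableAt ℝ γ t) (hδ : DifferentiableAt ℝ δ t)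
    (h : ∀ s, cdet (γ s) (δ s) = c) :
    cdet (γ t) (deriv δ t) = cdet (δ t) (deriv γ t) := by
  have key := (hasDerivAt_cdet hγ.hasDerivAt hδ.hasDerivAt).unique
    ((hasDerivAt_const t c).congr_of_eventuallyEq (Filter.Eventually.of_forall h))
  simp only [cdet] at key ⊢
  linarith

/-- Theorem 5.2 (Bianchi permutability): if `Γ` and `δ` are `b`- and `c`-related
to a centroaffine curve `γ`, then `Δ = (cδ − bΓ)/[Γ, δ]` is a centroaffine curve
that is `b`-related to `δ` and `c`-related to `Γ`, and for each `t` the points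
`δ(t), γ(t), Γ(t), Δ(t)` form a centroaffine butterfly. -/
theorem stmt14 (γ δ Γ : ℝ → ℝ × ℝ)
    (hγ : ContDiff ℝ (⊤ : ℕ∞) γ) (hδ : ContDiff ℝ (⊤ : ℕ∞) δ) (hΓ : ContDiff ℝ (⊤ : ℕ∞) Γ)
    (hγW : ∀ t, cdet (γ t) (deriv γ t) = 1)
    (hδW : ∀ t, cdet (δ t) (deriv δ t) = 1)
    (hΓW : ∀ t, cdet (Γ t) (deriv Γ t) = 1)
    (b c : ℝ) (hb : b ≠ 0) (hc : c ≠ 0)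
    (hγδ : ∀ t, cdet (γ t) (δ t) = c)
    (hγΓ : ∀ t, cdet (γ t) (Γ t) = b)
    (hΓδ : ∀ t, cdet (Γ t) (δ t) ≠ 0)
    (Δ : ℝ → ℝ × ℝ)
    (hΔ : ∀ t, Δ t = (cdet (Γ t) (δ t))⁻¹ • (c • δ t - b • Γ t)) :
    ∀ t, cdet (Δ t) (deriv Δ t) = 1 ∧
      cdet (δ t) (Δ t) = b ∧
      cdet (Γ t) (Δ t) = c ∧
      cdet (δ t) (γ t) = cdet (Δ t) (Γ t) ∧
      cdet (γ t) (Γ t) = cdet (δ t) (Δ t) := by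
  intro t
  have dγ : DifferentiableAt ℝ γ t := (hγ.differentiable (by simp)) t
  have dδ : DifferentiableAt ℝ δ t := (hδ.differentiable (by simp)) t
  have dΓ : DifferentiableAt ℝ Γ t := (hΓ.differentiable (by simp)) t
  have hf := hΓδ t
  have h₁ : cdet (δ t) (Δ t) = b := by
    have h : cdet (δ t) (Δ t) = (cdet (Γ t) (δ t))⁻¹ * cdet (Γ t) (δ t) * b := by
      rw [hΔ t]
      simp only [cdet, Prod.smul_fst, Prod.smul_snd, Prod.fst_sub, Prod.snd_sub, smul_eq_mul]
      ring
    rw [h, inv_mul_cancel₀ hf, one_mul]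
  have h₂ : cdet (Γ t) (Δ t) = c := by
    have h : cdet (Γ t) (Δ t) = (cdet (Γ t) (δ t))⁻¹ * cdet (Γ t) (δ t) * c := by
      rw [hΔ t]
      simp only [cdet, Prod.smul_fst, Prod.smul_snd, Prod.fst_sub, Prod.snd_sub, smul_eq_mul]
      ring
    rw [h, inv_mul_cancel₀ hf, one_mul]
  refine ⟨?_, h₁, h₂, ?_, by rw [h₁, hγΓ t]⟩
  · have hfinv := (hasDerivAt_cdet dΓ.hasDerivAt dδ.hasDerivAt).inv hf
    have hw := (dδ.hasDerivAt.const_smul c).sub (dΓ.hasDerivAt.const_smul b)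
    have hD : HasDerivAt Δ _ t :=
      (hfinv.smul hw).congr_of_eventuallyEq (Filter.Eventually.of_forall hΔ)
    rw [hD.deriv, hΔ t]
    refine (cdet_smul_smul_add _ _ _ _).trans ?_
    have hx := cdet_deriv_eq_of_cdet_const dγ dδ hγδ
    have hy := cdet_deriv_eq_of_cdet_const dγ dΓ hγΓ
    have expand := cdet_eq_of_cdet_eq_one (hγW t)
    have e₁ := expand (δ t) (deriv δ t)
    have e₂ := expand (Γ t) (deriv Γ t)
    have e₃ := expand (δ t) (deriv Γ t)
    have e₄ := expand (Γ t) (deriv δ t)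
    have e₅ := expand (Γ t) (δ t)
    rw [hδW t, hγδ t, hx] at e₁
    rw [hΓW t, hγΓ t, hy] at e₂
    rw [hγδ t, hy] at e₃
    rw [hγΓ t, hx] at e₄
    rw [hγδ t, hγΓ t] at e₅
    have hbil : cdet (c • δ t - b • Γ t) (c • deriv δ t - b • deriv Γ t) =
        c ^ 2 * cdet (δ t) (deriv δ t) + b ^ 2 * cdet (Γ t) (deriv Γ t)
          - b * c * (cdet (δ t) (deriv Γ t) + cdet (Γ t) (deriv δ t)) := by
      simp only [cdet, Prod.fst_sub, Prod.snd_sub, Prod.smul_fst, Prod.smul_snd, smul_eq_mul]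
      ring
    have hsq : cdet (c • δ t - b • Γ t) (c • deriv δ t - b • deriv Γ t) =
        cdet (Γ t) (δ t) ^ 2 := by
      rw [hbil, hδW t, hΓW t, e₃, e₄, e₅]
      linear_combination c ^ 2 * e₂ + b ^ 2 * e₁
    refine (congrArg _ hsq).trans ?_
    rw [← mul_pow, inv_mul_cancel₀ hf, one_pow]
  · have h₃ : cdet (δ t) (γ t) = -cdet (γ t) (δ t) := by simp only [cdet]; ring
    have h₄ : cdet (Δ t) (Γ t) = -cdet (Γ t) (Δ t) := by simp only [cdet]; ring
    rw [h₃, h₄, hγδ t, h₂]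
end

section
/- Let n ≥ 3 and let P : ℤ → ℝ² satisfy P_{i+n} = −P_i and [P_i, P_{i+1}] = 1 for all i ∈ ℤ. Suppose there is a constant c with [P_i, P_{i+2}] = c for all i. Then the polygon is centroaffine regular: there exists A ∈ SL(2, ℝ) such that P_{i+1} = A·P_i for all i ∈ ℤ. -/
open Real

/-- Two consecutive unit determinants and a constant second determinant force the
three-term recurrence with constant coefficient. -/
theorem eq_of_cdet_eq {u v w : ℝ × ℝ} {c : ℝ} (huv : cdet u v = 1) (hvw : cdet v w = 1)
    (huw : cdet u w = c) : w.1 = c * v.1 - u.1 ∧ w.2 = c * v.2 - u.2 := by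
  unfold cdet at *
  constructor
  · linear_combination (-w.1) * huv - u.1 * hvw + v.1 * huw
  · linear_combination (-w.2) * huv - u.2 * hvw + v.2 * huw

/-- A linear relation `z (i + 1) = a * x i + b * y i` between solutions of the same three-term
recurrence holds everywhere once it holds at two consecutive indices. -/
theorem linear_relation_of_recurrence {x y z : ℤ → ℝ} {a b c : ℝ}
    (hx : ∀ i, x (i + 2) = c * x (i + 1) - x i) (hy : ∀ i, y (i + 2) = c * y (i + 1) - y i)
    (hz : ∀ i, z (i + 2) = c * z (i + 1) - z i)
    (h0 : z 1 = a * x 0 + b * y 0) (h1 : z 2 = a * x 1 + b * y 1) (i : ℤ) :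
    z (i + 1) = a * x i + b * y i := by
  suffices h : z (i + 1) = a * x i + b * y i ∧ z (i + 2) = a * x (i + 1) + b * y (i + 1) from h.1
  induction i using Int.induction_on with
  | zero => simpa using And.intro h0 h1
  | succ i ih =>
    obtain ⟨h, h'⟩ := ih
    have hzi := hz (i + 1)
    simp only [add_assoc, one_add_one_eq_two, add_comm (1 : ℤ) 2] at hzi ⊢
    refine ⟨h', ?_⟩
    linear_combination hzi + c * h' - h - a * hx i - b * hy i
  | pred i ih =>
    obtain ⟨h, h'⟩ := ih
    have hxi := hx (-i - 1)
    have hyi := hy (-i - 1)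
    have hzi := hz (-i)
    rw [show (-i - 1 + 2 : ℤ) = -i + 1 by ring, show (-i - 1 + 1 : ℤ) = -i by ring] at hxi hyi
    rw [show (-i - 1 + 2 : ℤ) = -i + 1 by ring, show (-i - 1 + 1 : ℤ) = -i by ring]
    refine ⟨?_, h⟩
    linear_combination hzi - h' + c * h - a * hxi - b * hyi

/-- Theorem 5.5 (1): every self-Bäcklund `(n, 2)`-gon is trivial: if a
centroaffine `2n`-gon satisfies `[Pᵢ, P_{i+2}] = c` for all `i`, then it is
centroaffine regular, i.e. `P_{i+1} = A Pᵢ` for some `A ∈ SL(2, ℝ)`. -/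
theorem stmt17 (n : ℕ) (hn : 3 ≤ n)
    (P : ℤ → ℝ × ℝ)
    (hPa : ∀ i : ℤ, P (i + n) = -P i)
    (hPW : ∀ i : ℤ, cdet (P i) (P (i + 1)) = 1)
    (c : ℝ) (hsb : ∀ i : ℤ, cdet (P i) (P (i + 2)) = c) :
    ∃ A : Matrix (Fin 2) (Fin 2) ℝ, A.det = 1 ∧
      ∀ i : ℤ, P (i + 1)
        = (A 0 0 * (P i).1 + A 0 1 * (P i).2,
           A 1 0 * (P i).1 + A 1 1 * (P i).2) := by
  have hrec (i : ℤ) := eq_of_cdet_eq (hPW i)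
    (by simpa only [add_assoc, one_add_one_eq_two] using hPW (i + 1)) (hsb i)
  have hdet := hPW 0
  obtain ⟨hr1, hr2⟩ := hrec 0
  simp only [zero_add, cdet] at hdet hr1 hr2
  refine ⟨!![(P 1).1 * (P 1).2 - (P 0).2 * (P 2).1, (P 0).1 * (P 2).1 - (P 1).1 ^ 2;
    (P 1).2 ^ 2 - (P 0).2 * (P 2).2, (P 0).1 * (P 2).2 - (P 1).1 * (P 1).2], ?_, fun i ↦ ?_⟩
  · rw [Matrix.det_fin_two_of, hr1, hr2]
    linear_combination
      ((P 0).1 * (P 1).2 - (P 0).2 * (P 1).1 + 1) * hdet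
  · simp only [Matrix.of_apply, Matrix.cons_val', Matrix.cons_val_zero, Matrix.cons_val_one,
      Matrix.cons_val_fin_one]
    refine Prod.ext ?_ ?_
    · refine linear_relation_of_recurrence (x := fun i ↦ (P i).1) (y := fun i ↦ (P i).2)
        (z := fun i ↦ (P i).1) (fun i ↦ (hrec i).1) (fun i ↦ (hrec i).2)
        (fun i ↦ (hrec i).1) ?_ ?_ i
      · linear_combination -(P 1).1 * hdet
      · linear_combination -(P 2).1 * hdet
    · refine linear_relation_of_recurrence (x := fun i ↦ (P i).1) (y := fun i ↦ (P i).2)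
        (z := fun i ↦ (P i).2) (fun i ↦ (hrec i).1) (fun i ↦ (hrec i).2)
        (fun i ↦ (hrec i).2) ?_ ?_ i
      · linear_combination -(P 1).2 * hdet
      · linear_combination -(P 2).2 * hdet
end

section
/- Let k ≥ 2 and n = 2k + 1. Let P : ℤ → ℝ² satisfy P_{i+n} = −P_i and [P_i, P_{i+1}] = 1 for all i ∈ ℤ, and suppose there is a constant c ≠ 0 with [P_i, P_{i+k}] = c for all i. Then the polygon is centroaffine regular: there exists A ∈ SL(2, ℝ) such that P_{i+1} = A·P_i for all i ∈ ℤ. -/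
open Real

/-- The linear dependence between three plane vectors, solved for the last one. -/
lemma eq_cdet_smul_sub_of_cdet_eq_one {u v w : ℝ × ℝ} (huv : cdet u v = 1)
    (hvw : cdet v w = 1) : w = cdet u w • v - u := by
  unfold cdet at *
  ext
  · simp only [Prod.fst_sub, Prod.smul_fst, smul_eq_mul]
    linear_combination (-w.1) * huv - u.1 * hvw
  · simp only [Prod.snd_sub, Prod.smul_snd, smul_eq_mul]
    linear_combination (-w.2) * huv - u.2 * hvw

/-- The Ptolemy–Plücker relation for four plane vectors. -/
lemma cdet_plucker (u v w x : ℝ × ℝ) :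
    cdet u v * cdet w x + cdet v w * cdet u x = cdet u w * cdet v x := by
  unfold cdet
  ring

/-- A sequence satisfying a second order recurrence with constant coefficients, whose
consecutive determinants are `1`, is an orbit of an element of `SL(2, ℝ)`. -/
lemma exists_det_eq_one_of_recurrence {P : ℤ → ℝ × ℝ} {a : ℝ}
    (hPW : ∀ i : ℤ, cdet (P i) (P (i + 1)) = 1)
    (hrec : ∀ i : ℤ, P (i + 2) = a • P (i + 1) - P i) :
    ∃ A : Matrix (Fin 2) (Fin 2) ℝ, A.det = 1 ∧
      ∀ i : ℤ, P (i + 1)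
        = (A 0 0 * (P i).1 + A 0 1 * (P i).2,
           A 1 0 * (P i).1 + A 1 1 * (P i).2) := by
  have h0 : cdet (P 0) (P 1) = 1 := hPW 0
  have h1 : cdet (P 1) (P 2) = 1 := hPW 1
  have hrec1 : ∀ i : ℤ, (P (i + 2)).1 = a * (P (i + 1)).1 - (P i).1 := fun i => by
    simp [hrec i]
  have hrec2 : ∀ i : ℤ, (P (i + 2)).2 = a * (P (i + 1)).2 - (P i).2 := fun i => by
    simp [hrec i]
  unfold cdet at h0 h1
  refine ⟨!![(P 1).2 * (P 1).1 - (P 0).2 * (P 2).1, (P 0).1 * (P 2).1 - (P 1).1 * (P 1).1;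
    (P 1).2 * (P 1).2 - (P 0).2 * (P 2).2, (P 0).1 * (P 2).2 - (P 1).1 * (P 1).2], ?_, ?_⟩
  · rw [Matrix.det_fin_two_of]
    linear_combination ((P 1).1 * (P 2).2 - (P 1).2 * (P 2).1) * h0 + h1
  simp only [Matrix.of_apply, Matrix.cons_val', Matrix.cons_val_zero, Matrix.cons_val_one,
    Matrix.cons_val_fin_one, Prod.ext_iff]
  generalize hp : (P 1).2 * (P 1).1 - (P 0).2 * (P 2).1 = p
  generalize hq : (P 0).1 * (P 2).1 - (P 1).1 * (P 1).1 = q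
  generalize hr : (P 1).2 * (P 1).2 - (P 0).2 * (P 2).2 = r
  generalize hs : (P 0).1 * (P 2).2 - (P 1).1 * (P 1).2 = s
  suffices h : ∀ i : ℤ,
      ((P (i + 1)).1 = p * (P i).1 + q * (P i).2 ∧ (P (i + 1)).2 = r * (P i).1 + s * (P i).2) ∧
      ((P (i + 2)).1 = p * (P (i + 1)).1 + q * (P (i + 1)).2 ∧
        (P (i + 2)).2 = r * (P (i + 1)).1 + s * (P (i + 1)).2) from fun i => (h i).1
  intro i
  induction i using Int.induction_on with
  | zero =>
    simp only [zero_add]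
    subst hp hq hr hs
    refine ⟨⟨?_, ?_⟩, ?_, ?_⟩
    · linear_combination (-(P 1).1) * h0
    · linear_combination (-(P 1).2) * h0
    · linear_combination (-(P 2).1) * h0
    · linear_combination (-(P 2).2) * h0
  | succ i ih =>
    obtain ⟨⟨e1, e2⟩, e3, e4⟩ := ih
    have f1 := hrec1 i
    have f2 := hrec2 i
    have g1 := hrec1 (i + 1)
    have g2 := hrec2 (i + 1)
    rw [show (i : ℤ) + 1 + 1 = i + 2 by ring] at *
    refine ⟨⟨e3, e4⟩, ?_, ?_⟩
    · linear_combination g1 + a * e3 - e1 - p * f1 - q * f2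
    · linear_combination g2 + a * e4 - e2 - r * f1 - s * f2
  | pred i ih =>
    obtain ⟨⟨e1, e2⟩, e3, e4⟩ := ih
    have f1 := hrec1 (-i - 1)
    have f2 := hrec2 (-i - 1)
    have g1 := hrec1 (-i)
    have g2 := hrec2 (-i)
    rw [show -(i : ℤ) - 1 + 1 = -i by ring, show -(i : ℤ) - 1 + 2 = -i + 1 by ring] at *
    refine ⟨⟨?_, ?_⟩, e1, e2⟩
    · linear_combination g1 + a * e1 - e3 - p * f1 - q * f2
    · linear_combination g2 + a * e2 - e4 - r * f1 - s * f2

/-- Theorem 5.5 (3): for `n = 2k + 1`, every self-Bäcklund `(n, k)`-gon is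
trivial: if a centroaffine `2n`-gon satisfies `[Pᵢ, P_{i+k}] = c ≠ 0` for all
`i`, then it is centroaffine regular, i.e. `P_{i+1} = A Pᵢ` for some
`A ∈ SL(2, ℝ)`. -/
theorem stmt18 (k : ℕ) (hk : 2 ≤ k) (n : ℕ) (hn : n = 2 * k + 1)
    (P : ℤ → ℝ × ℝ)
    (hPa : ∀ i : ℤ, P (i + n) = -P i)
    (hPW : ∀ i : ℤ, cdet (P i) (P (i + 1)) = 1)
    (c : ℝ) (hc : c ≠ 0) (hsb : ∀ i : ℤ, cdet (P i) (P (i + k)) = c) :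
    ∃ A : Matrix (Fin 2) (Fin 2) ℝ, A.det = 1 ∧
      ∀ i : ℤ, P (i + 1)
        = (A 0 0 * (P i).1 + A 0 1 * (P i).2,
           A 1 0 * (P i).1 + A 1 1 * (P i).2) := by
  have hsb' : ∀ i : ℤ, cdet (P i) (P (i + k + 1)) = c := by
    intro i
    have h := hsb (i + k + 1)
    rw [show i + (k : ℤ) + 1 + k = i + n by rw [hn]; push_cast; ring, hPa i] at h
    rw [← h]
    simp only [cdet, Prod.fst_neg, Prod.snd_neg]
    ring
  have hd : ∀ i : ℤ, c * cdet (P (i + 1)) (P (i + k)) = c ^ 2 - 1 := by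
    intro i
    have h := cdet_plucker (P i) (P (i + 1)) (P (i + k)) (P (i + k + 1))
    have h' := hsb (i + 1)
    rw [show i + 1 + (k : ℤ) = i + k + 1 by ring] at h'
    rw [hPW, hPW, hsb, hsb', h'] at h
    linear_combination h
  refine exists_det_eq_one_of_recurrence (a := (2 * c ^ 2 - 1) / c ^ 2) hPW fun i => ?_
  have hi : cdet (P (i + 1)) (P (i + 1 + 1)) = 1 := hPW (i + 1)
  rw [show i + 1 + 1 = i + 2 by ring] at hi
  have hw := eq_cdet_smul_sub_of_cdet_eq_one (hPW i) hi
  have e0 := hd (i - k)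
  have e1 := hsb (i + 1 - k)
  have e2 := hsb' (i + 1 - k)
  rw [show i - (k : ℤ) + 1 = i + 1 - k by ring, show i - (k : ℤ) + k = i by ring] at e0
  rw [show i + 1 - (k : ℤ) + k = i + 1 by ring] at e1
  rw [show i + 1 - (k : ℤ) + k + 1 = i + 2 by ring, hw] at e2
  have hq : cdet (P i) (P (i + 2)) = (2 * c ^ 2 - 1) / c ^ 2 := by
    rw [eq_div_iff (pow_ne_zero 2 hc)]
    generalize cdet (P i) (P (i + 2)) = q at e2 ⊢
    simp only [cdet, Prod.fst_sub, Prod.snd_sub, Prod.smul_fst, Prod.smul_snd,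
      smul_eq_mul] at e0 e1 e2
    linear_combination c * e2 + e0 - c * q * e1
  rwa [hq] at hw
end

section
/- Let n and k be integers with n ≥ 5 and 2 ≤ k ≤ n/2, and for m ∈ ℤ set μ_m = sin(πm/n). Suppose that NONE of the following holds: (1) n is even and k is odd; (2) n = 2k with k even and k > 2; (3) there exists an integer j with 2 ≤ j ≤ n − 2 such that n = 2(k + j) and n divides (k − 1)(j − 1). Then for every n-periodic sequence c : ℤ → ℝ (c_{j+n} = c_j) and every constant C ∈ ℝ satisfying μ_{k−1}·c_j − μ_{k+1}·c_{j+1} + μ_{k+1}·c_{j+k} − μ_{k−1}·c_{j+k+1} = C for all j ∈ ℤ, one has C = 0 and there exist constants A, B, D ∈ ℝ such that c_j = A + B·cos(π(2j−1)/n) + D·sin(π(2j−1)/n) for all j. -/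
open Real

open Polynomial in
/-- An integer polynomial vanishing at one primitive `n`-th root of unity in `ℂ` vanishes at every
primitive `n`-th root of unity in every domain. -/
theorem aeval_eq_zero_of_primitiveRoot {n : ℕ} (hn : 0 < n) {ζ : ℂ} (hζ : IsPrimitiveRoot ζ n)
    {P : ℤ[X]} (h : aeval ζ P = 0) {R : Type*} [CommRing R] [IsDomain R] {g : R}
    (hg : IsPrimitiveRoot g n) : aeval g P = 0 := by
  have hdvd : cyclotomic n ℤ ∣ P := by
    rw [cyclotomic_eq_minpoly hζ hn]
    exact minpoly.isIntegrallyClosed_dvd (hζ.isIntegral hn) h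
  obtain ⟨Q, rfl⟩ := hdvd
  have h0 := hg.isRoot_cyclotomic hn
  rw [IsRoot.def, ← map_cyclotomic_int, eval_map] at h0
  rw [map_mul, aeval_def, algebraMap_int_eq, h0, zero_mul]

theorem relation_of_primitiveRoot {n : ℕ} (hn : 0 < n) {ζ : ℂ} (hζ : IsPrimitiveRoot ζ n)
    (k l : ℕ)
    (h : (1 - ζ ^ (k - 1)) * (1 - ζ ^ (l * (k + 1)))
      - ζ ^ (l - 1) * (1 - ζ ^ (k + 1)) * (1 - ζ ^ (l * (k - 1))) = 0)
    {R : Type*} [CommRing R] [IsDomain R] {g : R} (hg : IsPrimitiveRoot g n) :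
    (1 - g ^ (k - 1)) * (1 - g ^ (l * (k + 1)))
      - g ^ (l - 1) * (1 - g ^ (k + 1)) * (1 - g ^ (l * (k - 1))) = 0 := by
  have := aeval_eq_zero_of_primitiveRoot hn hζ
    (P := (1 - .X ^ (k - 1)) * (1 - .X ^ (l * (k + 1)))
      - .X ^ (l - 1) * (1 - .X ^ (k + 1)) * (1 - .X ^ (l * (k - 1)))) (by simpa using h) hg
  simpa using this

/-- If four complex numbers of modulus one sum to zero, they split into two opposite pairs. -/
theorem re_pairing_of_sum_eq_zero {x y z w : ℂ} (hx : ‖x‖ = 1) (hy : ‖y‖ = 1) (hz : ‖z‖ = 1)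
    (hw : ‖w‖ = 1) (h : x + y + z + w = 0) :
    (x.re + y.re = 0 ∧ z.re + w.re = 0) ∨ (x.re + z.re = 0 ∧ y.re + w.re = 0) ∨
      (x.re + w.re = 0 ∧ y.re + z.re = 0) := by
  have unit : ∀ {v : ℂ}, ‖v‖ = 1 → v * (starRingEnd ℂ) v = 1 := fun {v} hv => by
    rw [Complex.mul_conj, Complex.normSq_eq_norm_sq, hv]; simp
  have hc := congrArg (starRingEnd ℂ) h
  simp only [map_add, map_zero] at hc
  have key : (x + y) * ((x + z) * (x + w)) = 0 := by
    linear_combination (x + y) * x * h - x * y * h + x * y * z * w * hc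
      - y * z * w * unit hx - x * z * w * unit hy - x * y * w * unit hz
      - x * y * z * unit hw
  have hre := congrArg Complex.re h
  simp only [Complex.add_re, Complex.zero_re] at hre
  rcases mul_eq_zero.1 key with h1 | h1
  · have := congrArg Complex.re h1
    simp only [Complex.add_re, Complex.zero_re] at this
    exact .inl ⟨this, by linarith⟩
  rcases mul_eq_zero.1 h1 with h1 | h1
  · have := congrArg Complex.re h1
    simp only [Complex.add_re, Complex.zero_re] at this
    exact .inr (.inl ⟨this, by linarith⟩)
  · have := congrArg Complex.re h1
    simp only [Complex.add_re, Complex.zero_re] at this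
    exact .inr (.inr ⟨this, by linarith⟩)

/-- If the character sums `∑ i, u i * χ (a i * s)` vanish for all `s ≠ s₀`, and also at `s₀` unless
some residue class is avoided by `a`, then the sum of `u` over each fibre of `a` vanishes. -/
theorem sum_fiber_eq_zero {p : ℕ} [NeZero p] {ι : Type*} [Fintype ι] (u : ι → ℂ) (a : ι → ZMod p)
    (s₀ : ZMod p) (h : ∀ s, s ≠ s₀ → ∑ i, u i * ZMod.stdAddChar (a i * s) = 0)
    (h₀ : ∑ i, u i * ZMod.stdAddChar (a i * s₀) = 0 ∨ ∃ r₀, ∀ i, a i ≠ r₀) (r : ZMod p) :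
    ∑ i, (if a i = r then u i else 0) = 0 := by
  have key : ∀ r : ZMod p, (p : ℂ) * ∑ i, (if a i = r then u i else 0)
      = ZMod.stdAddChar (-(r * s₀)) * ∑ i, u i * ZMod.stdAddChar (a i * s₀) := by
    intro r
    have h1 : ∑ s : ZMod p, ZMod.stdAddChar (-(r * s)) * ∑ i, u i * ZMod.stdAddChar (a i * s)
        = (p : ℂ) * ∑ i, (if a i = r then u i else 0) := by
      simp_rw [Finset.mul_sum]
      rw [Finset.sum_comm]
      refine Finset.sum_congr rfl fun i _ => ?_
      have h2 := AddChar.sum_mulShift (a i - r) (ZMod.isPrimitive_stdAddChar p)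
      rw [ZMod.card] at h2
      calc _ = u i * ∑ s : ZMod p, ZMod.stdAddChar (s * (a i - r)) := by
            rw [Finset.mul_sum]
            refine Finset.sum_congr rfl fun s _ => ?_
            rw [show s * (a i - r) = -(r * s) + a i * s by ring, AddChar.map_add_eq_mul]
            ring
        _ = _ := by
            rw [h2]
            by_cases hr : a i = r
            · simp [hr, mul_comm]
            · simp [hr, sub_eq_zero]
    rw [← h1]
    refine Finset.sum_eq_single s₀ (fun s _ hs => by rw [h s hs, mul_zero]) (by simp)
  have hG : ∑ i, u i * ZMod.stdAddChar (a i * s₀) = 0 := by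
    rcases h₀ with h₀ | ⟨r₀, hr₀⟩
    · exact h₀
    · have := key r₀
      rw [Finset.sum_eq_zero (fun i _ => by rw [if_neg (hr₀ i)]), mul_zero] at this
      exact (mul_eq_zero.1 this.symm).resolve_left fun h0 => by
        simpa [h0] using AddChar.norm_apply (ZMod.stdAddChar (N := p)) (-(r₀ * s₀))
  have := key r
  rw [hG, mul_zero] at this
  exact (mul_eq_zero.1 this).resolve_left (NeZero.ne _)

/-- `e^{iπx/n}`. -/
noncomputable def halfRoot (n : ℕ) (x : ℤ) : ℂ := Complex.exp ((π * x / n : ℝ) * Complex.I)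

theorem norm_halfRoot (n : ℕ) (x : ℤ) : ‖halfRoot n x‖ = 1 := Complex.norm_exp_ofReal_mul_I _

theorem halfRoot_ne_zero (n : ℕ) (x : ℤ) : halfRoot n x ≠ 0 := Complex.exp_ne_zero _

theorem halfRoot_add (n : ℕ) (x y : ℤ) : halfRoot n (x + y) = halfRoot n x * halfRoot n y := by
  rw [halfRoot, halfRoot, halfRoot, ← Complex.exp_add]
  push_cast
  ring_nf

theorem conj_halfRoot (n : ℕ) (x : ℤ) : (starRingEnd ℂ) (halfRoot n x) = halfRoot n (-x) := by
  rw [halfRoot, halfRoot, ← Complex.exp_conj]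
  simp [neg_div]

theorem halfRoot_re (n : ℕ) (x : ℤ) : (halfRoot n x).re = cos (π * x / n) :=
  Complex.exp_ofReal_mul_I_re _

theorem halfRoot_mul_nat (n : ℕ) (x : ℤ) (m : ℕ) : halfRoot n (x * m) = halfRoot n x ^ m := by
  rw [halfRoot, halfRoot, ← Complex.exp_nat_mul]
  push_cast
  ring_nf

theorem isPrimitiveRoot_halfRoot {n : ℕ} (hn : n ≠ 0) : IsPrimitiveRoot (halfRoot n 2) n := by
  convert Complex.isPrimitiveRoot_exp n hn using 1
  rw [halfRoot]
  push_cast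
  ring_nf

/-- The alternating sum of four cosines equivalent to the vanishing of an eigenvalue, evaluated at
the `t`-th conjugate. -/
noncomputable def conjugateSum (n : ℕ) (a b c d t : ℤ) : ℂ :=
  (halfRoot n (a * t) + halfRoot n (-a * t)) - (halfRoot n (b * t) + halfRoot n (-b * t))
    - (halfRoot n (c * t) + halfRoot n (-c * t)) + (halfRoot n (d * t) + halfRoot n (-d * t))

theorem relation_eq_conjugateSum (n k l t : ℕ) (hk : 1 ≤ k) (hl : 1 ≤ l) {ζ : ℂ}
    (hζ : ζ = halfRoot n (2 * t)) :
    (1 - ζ ^ (k - 1)) * (1 - ζ ^ (l * (k + 1)))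
      - ζ ^ (l - 1) * (1 - ζ ^ (k + 1)) * (1 - ζ ^ (l * (k - 1))) =
    - (halfRoot n ((k - 1 + l * (k + 1)) * t) * conjugateSum n (k - 1 - l * (k + 1))
      (k - 1 + l * (k + 1)) (k + 1 - l * (k - 1)) (k + 1 + l * (k - 1)) t) := by
  obtain ⟨k, rfl⟩ := Nat.exists_eq_add_of_le' hk
  obtain ⟨l, rfl⟩ := Nat.exists_eq_add_of_le' hl
  have h1 : (1 : ℂ) = halfRoot n 0 := by simp [halfRoot]
  simp only [hζ, Nat.add_sub_cancel, ← halfRoot_mul_nat, conjugateSum, mul_add, mul_sub, sub_mul,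
    add_mul, ← halfRoot_add, h1, mul_one, one_mul, neg_add, neg_sub]
  push_cast
  ring_nf

/-- Whether `f` holds at all natural numbers below a bound. -/
def allBelow (f : ℕ → Bool) : ℕ → Bool
  | 0 => true
  | m + 1 => f m && allBelow f m

theorem of_allBelow {f : ℕ → Bool} : ∀ {m : ℕ}, allBelow f m = true → ∀ i < m, f i = true
  | 0, _, i, hi => absurd hi (Nat.not_lt_zero i)
  | m + 1, h, i, hi => by
    rw [allBelow, Bool.and_eq_true] at h
    rcases Nat.lt_succ_iff_lt_or_eq.1 hi with hi | rfl
    · exact of_allBelow h.2 i hi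
    · exact h.1

/-- The relation `(1 - g ^ (k - 1)) * (1 - g ^ (l * (k + 1))) =
g ^ (l - 1) * (1 - g ^ (k + 1)) * (1 - g ^ (l * (k - 1)))` modulo `211`, for `g = 2 ^ m`. -/
def relationMod (m k l : ℕ) : Bool :=
  Nat.beq
    ((1 + 2 ^ (m * (k - 1 + l * (k + 1)) % 210) + 2 ^ (m * (l - 1 + (k + 1)) % 210)
      + 2 ^ (m * (l - 1 + l * (k - 1)) % 210)) % 211)
    ((2 ^ (m * (k - 1) % 210) + 2 ^ (m * (l * (k + 1)) % 210) + 2 ^ (m * (l - 1) % 210)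
      + 2 ^ (m * (l - 1 + (k + 1) + l * (k - 1)) % 210)) % 211)

/-- The parameters `k`, `l` for which the regular `n`-gon may have a nontrivial deformation. -/
def exceptional (n k l : ℕ) : Bool :=
  Nat.beq n (2 * (k + l)) && Nat.beq ((k - 1) * (l - 1) % n) 0 ||
    Nat.beq n (2 * (k + (n - l))) && Nat.beq ((k - 1) * (n - l - 1) % n) 0

/-- Some conjugate of the relation fails modulo `211`, unless the parameters are exceptional. -/
def relationModFails (n k l : ℕ) : Bool :=
  !relationMod (210 / n) k l || exceptional n k l ||
  !([2, 3, 5, 11].all fun t => !Nat.beq (Nat.gcd t n) 1 || relationMod (210 / n * t) k l)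

theorem isPrimitiveRoot_two_zmod : IsPrimitiveRoot (2 : ZMod 211) 210 := by
  have h : orderOf (2 : ZMod 211) = 210 := by
    refine orderOf_eq_of_pow_and_pow_div_prime (by norm_num) (by decide +kernel) fun p hp hd => ?_
    have : p ∈ Nat.primeFactors 210 := Nat.mem_primeFactors.2 ⟨hp, hd, by norm_num⟩
    rw [show Nat.primeFactors 210 = {2, 3, 5, 7} by decide +kernel] at this
    simp only [Finset.mem_insert, Finset.mem_singleton] at this
    rcases this with rfl | rfl | rfl | rfl <;> decide +kernel
  exact h ▸ IsPrimitiveRoot.orderOf 2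

instance fact_prime_two_hundred_eleven : Fact (Nat.Prime 211) := ⟨by norm_num⟩

theorem relationMod_of_relation {m k l : ℕ} {g : ZMod 211} (hg : g = 2 ^ m)
    (h : (1 - g ^ (k - 1)) * (1 - g ^ (l * (k + 1)))
      - g ^ (l - 1) * (1 - g ^ (k + 1)) * (1 - g ^ (l * (k - 1))) = 0) :
    relationMod m k l = true := by
  have hpow : ∀ e : ℕ, (2 : ZMod 211) ^ (m * e % 210) = g ^ e := fun e => by
    rw [hg, ← pow_mul, ← pow_eq_pow_mod _ isPrimitiveRoot_two_zmod.pow_eq_one]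
  rw [relationMod, Nat.beq_eq, ← ZMod.natCast_eq_natCast_iff']
  push_cast
  rw [hpow, hpow, hpow, hpow, hpow, hpow, hpow]
  linear_combination h

theorem exceptional_of_dvd_two_hundred_ten {n k l : ℕ} (h5 : 5 ≤ n) (hn : n ∣ 210) (hk : 2 ≤ k)
    (hkn : 2 * k < n) (hpar : ¬ (Even n ∧ Odd k)) (hl : 2 ≤ l) (hln : l ≤ n - 2)
    (hrel : ∀ g : ZMod 211, IsPrimitiveRoot g n → (1 - g ^ (k - 1)) * (1 - g ^ (l * (k + 1)))
      - g ^ (l - 1) * (1 - g ^ (k + 1)) * (1 - g ^ (l * (k - 1))) = 0) :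
    (n = 2 * (k + l) ∧ n ∣ (k - 1) * (l - 1)) ∨
      (n = 2 * (k + (n - l)) ∧ n ∣ (k - 1) * (n - l - 1)) := by
  have key : allBelow (fun n => Nat.ble n 4 || !Nat.beq (210 % n) 0 ||
      allBelow (fun k => Nat.ble k 1 || Nat.beq (n % 2) 0 && Nat.beq (k % 2) 1 ||
        allBelow (fun l => Nat.ble l 1 || relationModFails n k l) (n - 1)) ((n + 1) / 2)) 211 := by
    decide +kernel
  have h1 := of_allBelow key n (Nat.lt_succ_of_le (Nat.le_of_dvd (by norm_num) hn))
  simp only [Bool.or_eq_true, Bool.not_eq_true', Nat.ble_eq, ← Bool.not_eq_true, Nat.beq_eq] at h1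
  replace h1 := (h1.resolve_left (by rw [Nat.mod_eq_zero_of_dvd hn]; omega))
  have h2 := of_allBelow h1 k (by omega)
  simp only [Bool.or_eq_true, Bool.and_eq_true, Nat.ble_eq, Nat.beq_eq] at h2
  replace h2 := h2.resolve_left (by
    rintro (h | ⟨h, h'⟩)
    · omega
    · exact hpar ⟨Nat.even_iff.2 h, Nat.odd_iff.2 h'⟩)
  have h3 := of_allBelow h2 l (by omega)
  simp only [Bool.or_eq_true, Nat.ble_eq] at h3
  replace h3 := h3.resolve_left (by omega)
  have hg : IsPrimitiveRoot ((2 : ZMod 211) ^ (210 / n)) n :=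
    isPrimitiveRoot_two_zmod.pow (by norm_num) (Nat.div_mul_cancel hn).symm
  rw [relationModFails, Bool.or_eq_true, Bool.or_eq_true, relationMod_of_relation rfl (hrel _ hg)]
    at h3
  rcases h3 with (h3 | h3) | h3
  · simp at h3
  · simpa [exceptional, Nat.dvd_iff_mod_eq_zero] using h3
  · exfalso
    rw [Bool.not_eq_true', ← Bool.not_eq_true] at h3
    refine h3 (List.all_eq_true.2 fun t _ => ?_)
    by_cases ht : Nat.gcd t n = 1
    · rw [relationMod_of_relation (pow_mul _ _ _).symm (hrel _ (hg.pow_of_coprime t ht))]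
      simp
    · rw [← Nat.beq_eq, Bool.not_eq_true] at ht
      rw [ht]
      rfl

/-- Four real numbers split into two pairs of opposite numbers. -/
def SplitsIntoPairs (x y z w : ℝ) : Prop :=
  (x + y = 0 ∧ z + w = 0) ∨ (x + z = 0 ∧ y + w = 0) ∨ (x + w = 0 ∧ y + z = 0)

/-- The contribution of the conjugate pair `w`, `conj w`, placed in the residue classes `a`, `-a`,
to the class `r`. -/
noncomputable def fiberTerm {K : Type*} [Neg K] [DecidableEq K] (a : K) (w : ℂ) (r : K) : ℂ :=
  (if a = r then w else 0) + if -a = r then (starRingEnd ℂ) w else 0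

theorem fiberTerm_cases {K : Type*} [AddCommGroup K] [DecidableEq K] {a r : K} {w : ℂ}
    (hr : r ≠ -r) (hw : ‖w‖ = 1) :
    (∃ v : ℂ, ‖v‖ = 1 ∧ v.re = w.re ∧ fiberTerm a w r = v ∧ (a = r ∨ a = -r)) ∨
      (fiberTerm a w r = 0 ∧ a ≠ r ∧ a ≠ -r) := by
  by_cases h1 : a = r
  · exact .inl ⟨w, hw, rfl, by simp [fiberTerm, h1, hr.symm], .inl h1⟩
  by_cases h2 : a = -r
  · exact .inl ⟨(starRingEnd ℂ) w, by simpa using hw, by simp,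
      by simp [fiberTerm, h2, hr.symm], .inr h2⟩
  · exact .inr ⟨by simp [fiberTerm, h1, neg_eq_iff_eq_neg, h2], h1, h2⟩

section

variable {K : Type*} [AddCommGroup K] [DecidableEq K] {a b c d : K} {x y z w : ℂ}

theorem ne_zero_of_fiberTerm (hK : ∀ u : K, u = -u → u = 0) (ha : a ≠ 0) (hx : ‖x‖ = 1) :
    fiberTerm a x a ≠ 0 := by
  have : -a ≠ a := fun h => ha (hK a h.symm)
  have hx0 : x ≠ 0 := fun h => by simp [h] at hx
  simpa [fiberTerm, this] using hx0

theorem eq_zero_of_fiberTerm (hK : ∀ u : K, u = -u → u = 0) (ha : a ≠ 0) (hw : ‖w‖ = 1)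
    (hb : b = a ∨ b = -a) (hc : c = a ∨ c = -a) (hda : d ≠ a) (hda' : d ≠ -a)
    (hsum : ∀ r, fiberTerm a x r + fiberTerm b y r + fiberTerm c z r + fiberTerm d w r = 0) :
    d = 0 := by
  by_contra hd
  refine ne_zero_of_fiberTerm hK hd hw ?_
  have h0 : ∀ {u : K} {v : ℂ}, u = a ∨ u = -a → fiberTerm u v d = 0 := fun {u v} hu => by
    have h1 : u ≠ d := by rintro rfl; exact hu.elim hda hda'
    have h2 : -u ≠ d := by
      rintro rfl
      rcases hu with rfl | rfl
      · exact hda' rfl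
      · exact hda (neg_neg a)
    simp [fiberTerm, h1, h2]
  have := hsum d
  rwa [h0 (.inl rfl), h0 hb, h0 hc, zero_add, zero_add, zero_add] at this

theorem splitsIntoPairs_of_fiberTerm_of_ne_zero (hK : ∀ u : K, u = -u → u = 0)
    (hx : ‖x‖ = 1) (hy : ‖y‖ = 1) (hz : ‖z‖ = 1) (hw : ‖w‖ = 1)
    (hsum : ∀ r, fiberTerm a x r + fiberTerm b y r + fiberTerm c z r + fiberTerm d w r = 0)
    (hre : x.re + y.re + z.re + w.re = 0) (ha : a ≠ 0)
    (hd : ¬ (d = 0 ∧ (b = a ∨ b = -a) ∧ (c = a ∨ c = -a)))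
    (hc : ¬ (c = 0 ∧ (b = a ∨ b = -a) ∧ (d = a ∨ d = -a)))
    (hb : ¬ (b = 0 ∧ (c = a ∨ c = -a) ∧ (d = a ∨ d = -a))) :
    SplitsIntoPairs x.re y.re z.re w.re := by
  have hr : a ≠ -a := fun h => ha (hK a h)
  have h := hsum a
  have hxx : fiberTerm a x a = x := by simp [fiberTerm, hr.symm]
  have re_eq : ∀ {u v : ℂ}, u + v = 0 → u.re + v.re = 0 := fun {u v} h => by
    simpa using congrArg Complex.re h
  rcases fiberTerm_cases (a := b) hr hy with ⟨y', hy', hyr, hy1, hb1⟩ | ⟨hy1, hb1, hb2⟩ <;>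
  rcases fiberTerm_cases (a := c) hr hz with ⟨z', hz', hzr, hz1, hc1⟩ | ⟨hz1, hc1, hc2⟩ <;>
  rcases fiberTerm_cases (a := d) hr hw with ⟨w', hw', hwr, hw1, hd1⟩ | ⟨hw1, hd1, hd2⟩ <;>
  simp only [hxx, hy1, hz1, hw1, add_zero] at h
  · have := re_pairing_of_sum_eq_zero hx hy' hz' hw' h
    rwa [hyr, hzr, hwr] at this
  · exact absurd ⟨eq_zero_of_fiberTerm hK ha hw hb1 hc1 hd1 hd2 hsum, hb1, hc1⟩ hd
  · exact absurd ⟨eq_zero_of_fiberTerm (d := c) (c := d) hK ha hz hb1 hd1 hc1 hc2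
      fun r => by rw [← hsum r]; ring, hb1, hd1⟩ hc
  · have := re_eq h
    exact .inl ⟨by linarith, by linarith⟩
  · exact absurd ⟨eq_zero_of_fiberTerm (d := b) (b := d) hK ha hy hd1 hc1 hb1 hb2
      fun r => by rw [← hsum r]; ring, hc1, hd1⟩ hb
  · have := re_eq h
    exact .inr (.inl ⟨by linarith, by linarith⟩)
  · have := re_eq h
    exact .inr (.inr ⟨by linarith, by linarith⟩)
  · simp [h] at hx

theorem SplitsIntoPairs.swap_left {x y z w : ℝ} (h : SplitsIntoPairs x y z w) :
    SplitsIntoPairs y x z w := by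
  unfold SplitsIntoPairs at *; grind

theorem SplitsIntoPairs.swap_middle {x y z w : ℝ} (h : SplitsIntoPairs x y z w) :
    SplitsIntoPairs x z y w := by
  unfold SplitsIntoPairs at *; grind

theorem SplitsIntoPairs.swap_right {x y z w : ℝ} (h : SplitsIntoPairs x y z w) :
    SplitsIntoPairs x y w z := by
  unfold SplitsIntoPairs at *; grind

theorem splitsIntoPairs_of_fiberTerm (hK : ∀ u : K, u = -u → u = 0)
    (hx : ‖x‖ = 1) (hy : ‖y‖ = 1) (hz : ‖z‖ = 1) (hw : ‖w‖ = 1)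
    (hsum : ∀ r, fiberTerm a x r + fiberTerm b y r + fiberTerm c z r + fiberTerm d w r = 0)
    (hre : x.re + y.re + z.re + w.re = 0) (h0 : ¬ (a = 0 ∧ b = 0 ∧ c = 0 ∧ d = 0))
    (ha : ¬ (a = 0 ∧ (c = b ∨ c = -b) ∧ (d = b ∨ d = -b)))
    (hb : ¬ (b = 0 ∧ (c = a ∨ c = -a) ∧ (d = a ∨ d = -a)))
    (hc : ¬ (c = 0 ∧ (b = a ∨ b = -a) ∧ (d = a ∨ d = -a)))
    (hd : ¬ (d = 0 ∧ (b = a ∨ b = -a) ∧ (c = a ∨ c = -a))) :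
    SplitsIntoPairs x.re y.re z.re w.re := by
  by_cases ha0 : a = 0
  · by_cases hb0 : b = 0
    · subst ha0 hb0
      by_cases hc0 : c = 0
      · subst hc0
        have := splitsIntoPairs_of_fiberTerm_of_ne_zero (a := d) (b := 0) (c := 0) (d := 0) hK
          hw hx hy hz (fun r => by rw [← hsum r]; ring) (by linarith) (by tauto) (by grind)
          (by grind) (by grind)
        exact this.swap_left.swap_middle.swap_right
      · have := splitsIntoPairs_of_fiberTerm_of_ne_zero (a := c) (b := 0) (c := 0) (d := d) hK
          hz hx hy hw (fun r => by rw [← hsum r]; ring) (by linarith) hc0 (by grind)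
          (by grind) (by grind)
        exact this.swap_left.swap_middle
    · subst ha0
      have := splitsIntoPairs_of_fiberTerm_of_ne_zero (a := b) (b := 0) (c := c) (d := d) hK
        hy hx hz hw (fun r => by rw [← hsum r]; ring) (by linarith) hb0 (by grind)
        (by grind) (by grind)
      exact this.swap_left
  · exact splitsIntoPairs_of_fiberTerm_of_ne_zero hK hx hy hz hw hsum hre ha0 hd hc hb

end

/-- In a field of characteristic other than two, three of the residues of the frequencies cannot
agree up to sign when the fourth is zero. -/
theorem not_exceptional_residues {K : Type*} [Field K] (h2 : (2 : K) ≠ 0) (x y : K)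
    (ha : x - 1 - y * (x + 1) = 0)
    (hc : x + 1 - y * (x - 1) = x - 1 + y * (x + 1) ∨
      x + 1 - y * (x - 1) = -(x - 1 + y * (x + 1)))
    (hd : x + 1 + y * (x - 1) = x - 1 + y * (x + 1) ∨
      x + 1 + y * (x - 1) = -(x - 1 + y * (x + 1))) : False := by
  have half : ∀ {u : K}, 2 * u = 0 → u = 0 := fun h => (mul_eq_zero.1 h).resolve_left h2
  have hd' : y = 1 ∨ x = 0 ∨ y = -1 := by
    rcases hd with hd | hd
    · exact .inl (by linear_combination -half (u := 1 - y) (by linear_combination hd))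
    · refine .inr ?_
      rcases mul_eq_zero.1 (half (u := x * (1 + y)) (by linear_combination hd)) with h | h
      · exact .inl h
      · exact .inr (by linear_combination h)
  have hc' : 1 - x * y = 0 ∨ x = -y := by
    rcases hc with hc | hc
    · exact .inl (half (by linear_combination hc))
    · exact .inr (by linear_combination half (u := x + y) (by linear_combination hc))
  rcases hd' with rfl | rfl | rfl
  · exact h2 (by linear_combination -ha)
  · rcases hc' with h | h
    · simp at h
    · have : y = 0 := by linear_combination h
      subst this
      simp at ha
  · have : x = 0 := half (by linear_combination ha)
    subst this
    rcases hc' with h | h <;> simp at h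

theorem conjugateSum_eq_zero {n k l : ℕ} (hn : n ≠ 0) (hk : 1 ≤ k) (hl : 1 ≤ l) {a b c d : ℤ}
    (ha : a = k - 1 - l * (k + 1)) (hb : b = k - 1 + l * (k + 1)) (hc : c = k + 1 - l * (k - 1))
    (hd : d = k + 1 + l * (k - 1)) (h : conjugateSum n a b c d 1 = 0) {t : ℕ}
    (ht : t.Coprime n) : conjugateSum n a b c d t = 0 := by
  subst ha hb hc hd
  have hζ := isPrimitiveRoot_halfRoot hn
  have h1 := relation_eq_conjugateSum n k l 1 hk hl (ζ := halfRoot n 2) (by simp)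
  rw [Nat.cast_one, h, mul_zero, neg_zero] at h1
  have h2 := relation_of_primitiveRoot (Nat.pos_of_ne_zero hn) hζ k l h1 (hζ.pow_of_coprime t ht)
  rw [relation_eq_conjugateSum n k l t hk hl (halfRoot_mul_nat n 2 t).symm, neg_eq_zero,
    mul_eq_zero] at h2
  exact h2.resolve_left (halfRoot_ne_zero _ _)

theorem halfRoot_mul_eq_stdAddChar {p m : ℕ} [NeZero p] (hm : m ≠ 0) (a : ℤ) (s : ZMod p) :
    halfRoot (p * m) (a * ((1 + 2 * m * s.val : ℕ) : ℤ)) =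
      halfRoot (p * m) a * ZMod.stdAddChar ((a : ZMod p) * s) := by
  have h : (a : ZMod p) * s = ((a * s.val : ℤ) : ZMod p) := by simp
  rw [show a * ((1 + 2 * m * s.val : ℕ) : ℤ) = a + a * (2 * m * s.val) by push_cast; ring,
    halfRoot_add, h, ZMod.stdAddChar_coe]
  congr 1
  rw [halfRoot]
  congr 1
  have : (p : ℂ) ≠ 0 := NeZero.ne _
  have : (m : ℂ) ≠ 0 := Nat.cast_ne_zero.2 hm
  push_cast
  field_simp

theorem fiberTerm_sum_eq_zero {p m : ℕ} (hp : p.Prime) (hp2 : p ≠ 2) (hm : m ≠ 0)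
    (hpm : p ∣ m ∨ 11 ≤ p) {a b c d : ℤ}
    (h : ∀ t : ℕ, t.Coprime (p * m) → conjugateSum (p * m) a b c d t = 0) (r : ZMod p) :
    fiberTerm (a : ZMod p) (halfRoot (p * m) a) r + fiberTerm (b : ZMod p) (-halfRoot (p * m) b) r
      + fiberTerm (c : ZMod p) (-halfRoot (p * m) c) r
      + fiberTerm (d : ZMod p) (halfRoot (p * m) d) r = 0 := by
  have : Fact p.Prime := ⟨hp⟩
  let u : Fin 8 → ℂ := ![halfRoot (p * m) a, halfRoot (p * m) (-a), -halfRoot (p * m) b,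
    -halfRoot (p * m) (-b), -halfRoot (p * m) c, -halfRoot (p * m) (-c), halfRoot (p * m) d,
    halfRoot (p * m) (-d)]
  let e : Fin 8 → ZMod p := ![a, -a, b, -b, c, -c, d, -d]
  have hsum : ∀ s : ZMod p, (1 + 2 * m * s.val : ℕ).Coprime (p * m) →
      ∑ i, u i * ZMod.stdAddChar (e i * s) = 0 := fun s hs => by
    rw [← h _ hs, Fin.sum_univ_eight]
    simp only [conjugateSum, halfRoot_mul_eq_stdAddChar hm, Int.cast_neg]
    simp only [u, e, Matrix.cons_val]
    ring
  have hcop : ∀ s : ZMod p, (1 + 2 * m * s.val : ℕ).Coprime p →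
      (1 + 2 * m * s.val : ℕ).Coprime (p * m) := fun s hs => by
    refine Nat.Coprime.mul_right hs ?_
    rw [show 1 + 2 * m * s.val = 1 + m * (2 * s.val) by ring]
    simp
  have hfib : ∑ i, (if e i = r then u i else 0) = 0 := by
    by_cases hpm' : p ∣ m
    · have hall : ∀ s : ZMod p, ∑ i, u i * ZMod.stdAddChar (e i * s) = 0 := fun s => by
        refine hsum s (hcop s ?_)
        obtain ⟨q, rfl⟩ := hpm'
        rw [show 1 + 2 * (p * q) * s.val = 1 + p * (2 * q * s.val) by ring]
        simp
      exact sum_fiber_eq_zero u e 0 (fun s _ => hall s) (.inl (hall 0)) r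
    · have hm0 : (2 * m : ZMod p) ≠ 0 := by
        have : ((2 * m : ℕ) : ZMod p) ≠ 0 := by
          rw [Ne, ZMod.natCast_eq_zero_iff, hp.dvd_mul]
          rintro (h2 | h2)
          · exact hp2 ((Nat.prime_dvd_prime_iff_eq hp Nat.prime_two).1 h2)
          · exact hpm' h2
        simpa using this
      refine sum_fiber_eq_zero u e (-(2 * m : ZMod p)⁻¹) (fun s hs => hsum s (hcop s ?_))
        (.inr ?_) r
      · rw [Nat.coprime_comm, hp.coprime_iff_not_dvd, ← ZMod.natCast_eq_zero_iff]
        intro h0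
        push_cast at h0
        rw [ZMod.natCast_zmod_val] at h0
        refine hs ?_
        refine mul_left_cancel₀ hm0 ?_
        rw [mul_neg, mul_inv_cancel₀ hm0]
        linear_combination h0
      · by_contra! hsurj
        have := Fintype.card_le_of_surjective e hsurj
        rw [ZMod.card, Fintype.card_fin] at this
        have := hpm.resolve_left hpm'
        omega
  rw [← hfib, Fin.sum_univ_eight]
  simp only [u, e, fiberTerm, Matrix.cons_val, map_neg, conj_halfRoot, ← add_assoc]
  congr!

theorem sum_re_eq_zero {n : ℕ} {a b c d t : ℤ} (h : conjugateSum n a b c d t = 0) :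
    (halfRoot n (a * t)).re + (-halfRoot n (b * t)).re + (-halfRoot n (c * t)).re
      + (halfRoot n (d * t)).re = 0 := by
  have := congrArg Complex.re h
  simp only [conjugateSum, neg_mul, ← conj_halfRoot, Complex.add_re, Complex.sub_re,
    Complex.conj_re, Complex.zero_re] at this
  simp only [Complex.neg_re]
  linarith

/-- The relation is trivial when `n` has an odd prime factor that is at least `11` or whose square
divides `n`. -/
theorem splitsIntoPairs_of_prime {n p k l : ℕ} (hn : n ≠ 0) (hk : 1 ≤ k) (hl : 1 ≤ l)
    {a b c d : ℤ} (ha : a = k - 1 - l * (k + 1)) (hb : b = k - 1 + l * (k + 1))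
    (hc : c = k + 1 - l * (k - 1)) (hd : d = k + 1 + l * (k - 1))
    (h : conjugateSum n a b c d 1 = 0) (hp : p.Prime) (hp2 : p ≠ 2) (hpn : p ∣ n)
    (hpm : p * p ∣ n ∨ 11 ≤ p) :
    SplitsIntoPairs (halfRoot n a).re (-halfRoot n b).re (-halfRoot n c).re (halfRoot n d).re := by
  have : Fact p.Prime := ⟨hp⟩
  obtain ⟨m, rfl⟩ := hpn
  have hm : m ≠ 0 := fun h => hn (by simp [h])
  have h2 : (2 : ZMod p) ≠ 0 := by
    have : ((2 : ℕ) : ZMod p) ≠ 0 := by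
      rw [Ne, ZMod.natCast_eq_zero_iff, Nat.prime_dvd_prime_iff_eq hp Nat.prime_two]
      exact hp2
    simpa using this
  have hK : ∀ u : ZMod p, u = -u → u = 0 := fun u hu => by
    have : 2 * u = 0 := by linear_combination hu
    exact (mul_eq_zero.1 this).resolve_left h2
  have hpm' : p ∣ m ∨ 11 ≤ p := hpm.imp_left (Nat.dvd_of_mul_dvd_mul_left hp.pos)
  have hsum := fiberTerm_sum_eq_zero hp hp2 hm hpm'
    fun t ht => conjugateSum_eq_zero hn hk hl ha hb hc hd h ht
  have ha' : (a : ZMod p) = k - 1 - l * (k + 1) := by rw [ha]; push_cast; ring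
  have hb' : (b : ZMod p) = k - 1 + l * (k + 1) := by rw [hb]; push_cast; ring
  have hc' : (c : ZMod p) = k + 1 - l * (k - 1) := by rw [hc]; push_cast; ring
  have hd' : (d : ZMod p) = k + 1 + l * (k - 1) := by rw [hd]; push_cast; ring
  rw [ha', hb', hc', hd'] at hsum
  generalize (k : ZMod p) = x at hsum
  generalize (l : ZMod p) = y at hsum
  refine splitsIntoPairs_of_fiberTerm hK (norm_halfRoot _ _) (by simp [norm_halfRoot])
    (by simp [norm_halfRoot]) (norm_halfRoot _ _) hsum
    (by simpa using sum_re_eq_zero h) ?_ ?_ ?_ ?_ ?_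
  · rintro ⟨h1, h2', h3, h4⟩
    have : (2 * 2 : ZMod p) = 0 := by linear_combination h3 + h4 - h1 - h2'
    exact h2 (by simpa using this)
  · rintro ⟨h1, h3, h4⟩
    exact not_exceptional_residues h2 x y h1 h3 h4
  · rintro ⟨h1, h3, h4⟩
    refine not_exceptional_residues h2 x (-y) ?_ ?_ ?_ <;> grind
  · rintro ⟨h1, h3, h4⟩
    refine not_exceptional_residues h2 (-x) y ?_ ?_ ?_ <;> grind
  · rintro ⟨h1, h3, h4⟩
    refine not_exceptional_residues h2 (-x) (-y) ?_ ?_ ?_ <;> grind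

theorem halfRoot_four_mul_re {q : ℕ} (hq : q ≠ 0) (m r : ℤ) :
    (halfRoot (4 * q) ((4 * m + r) * ((1 + 2 * q : ℕ) : ℤ))).re =
      cos (π * ((4 * m + r : ℤ) : ℝ) / (4 * q : ℕ) + r * (π / 2)) := by
  have : (q : ℝ) ≠ 0 := Nat.cast_ne_zero.2 hq
  rw [halfRoot_re, ← cos_add_int_mul_two_pi (_ + _) m]
  congr 1
  push_cast
  field_simp
  ring

theorem halfRoot_four_mul_re_of_odd {q : ℕ} (hq : q ≠ 0) {a : ℤ} (ha : Odd a) :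
    ∃ v : ℂ, ‖v‖ = 1 ∧ v.re = (halfRoot (4 * q) a).re ∧
      (halfRoot (4 * q) (a * ((1 + 2 * q : ℕ) : ℤ))).re = v.im := by
  have hnorm := norm_halfRoot (4 * q) a
  have him : (halfRoot (4 * q) a).im = sin (π * a / (4 * q : ℕ)) :=
    Complex.exp_ofReal_mul_I_im _
  obtain ⟨m, rfl | rfl⟩ : ∃ m : ℤ, a = 4 * m + 1 ∨ a = 4 * m + (-1) := by
    obtain ⟨s, rfl⟩ := ha
    obtain ⟨u, rfl | rfl⟩ := Int.even_or_odd' s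
    · exact ⟨u, .inl (by ring)⟩
    · exact ⟨u + 1, .inr (by ring)⟩
  · refine ⟨_, (Complex.norm_conj _).trans hnorm, Complex.conj_re _, ?_⟩
    rw [halfRoot_four_mul_re hq, Complex.conj_im, him, Int.cast_one, one_mul, cos_add_pi_div_two]
  · refine ⟨_, hnorm, rfl, ?_⟩
    rw [halfRoot_four_mul_re hq, him, Int.cast_neg, Int.cast_one, neg_one_mul, ← sub_eq_add_neg,
      cos_sub_pi_div_two]

theorem halfRoot_four_mul_re_of_dvd {q : ℕ} (hq : q ≠ 0) {a : ℤ} (ha : 4 ∣ a) :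
    (halfRoot (4 * q) (a * ((1 + 2 * q : ℕ) : ℤ))).re = (halfRoot (4 * q) a).re := by
  obtain ⟨m, rfl⟩ := ha
  have := halfRoot_four_mul_re hq m 0
  rw [add_zero] at this
  rw [this, halfRoot_re]
  simp

theorem halfRoot_four_mul_re_of_dvd_sub {q : ℕ} (hq : q ≠ 0) {a : ℤ} (ha : 4 ∣ a - 2) :
    (halfRoot (4 * q) (a * ((1 + 2 * q : ℕ) : ℤ))).re = -(halfRoot (4 * q) a).re := by
  obtain ⟨m, hm⟩ := ha
  obtain rfl : a = 4 * m + 2 := by linarith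
  rw [halfRoot_four_mul_re hq, halfRoot_re, ← cos_add_pi]
  push_cast
  ring_nf

/-- The relation is trivial when `4 ∣ n`. -/
theorem splitsIntoPairs_of_four_dvd {n k l : ℕ} (hn : n ≠ 0) (hk : 1 ≤ k) (hl : 1 ≤ l)
    {a b c d : ℤ} (ha : a = k - 1 - l * (k + 1)) (hb : b = k - 1 + l * (k + 1))
    (hc : c = k + 1 - l * (k - 1)) (hd : d = k + 1 + l * (k - 1))
    (h : conjugateSum n a b c d 1 = 0) (hn4 : 4 ∣ n) (hk2 : Even k) :
    SplitsIntoPairs (halfRoot n a).re (-halfRoot n b).re (-halfRoot n c).re (halfRoot n d).re := by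
  obtain ⟨q, rfl⟩ := hn4
  have hq : q ≠ 0 := fun h => hn (by simp [h])
  have hcop : (1 + 2 * q).Coprime (4 * q) := by
    refine Nat.Coprime.mul_right ?_ (by simp)
    exact Nat.Coprime.pow_right 2 (m := 2) (by simp)
  have e1 := sum_re_eq_zero h
  have e2 := sum_re_eq_zero (conjugateSum_eq_zero hn hk hl ha hb hc hd h hcop)
  simp only [mul_one, Complex.neg_re] at e1 e2
  obtain ⟨i, rfl⟩ := hk2
  push_cast at ha hb hc hd
  obtain ⟨j, hj | hj⟩ := Int.even_or_odd' (l : ℤ)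
  · obtain ⟨u, hu, hu1, hu2⟩ := halfRoot_four_mul_re_of_odd hq (a := a)
      ⟨i - 1 - j * (i + i + 1), by rw [ha, hj]; ring⟩
    obtain ⟨v, hv, hv1, hv2⟩ := halfRoot_four_mul_re_of_odd hq (a := b)
      ⟨i - 1 + j * (i + i + 1), by rw [hb, hj]; ring⟩
    obtain ⟨w, hw, hw1, hw2⟩ := halfRoot_four_mul_re_of_odd hq (a := c)
      ⟨i - j * (i + i - 1), by rw [hc, hj]; ring⟩
    obtain ⟨z, hz, hz1, hz2⟩ := halfRoot_four_mul_re_of_odd hq (a := d)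
      ⟨i + j * (i + i - 1), by rw [hd, hj]; ring⟩
    rw [hu2, hv2, hw2, hz2] at e2
    have := re_pairing_of_sum_eq_zero hu ((norm_neg v).trans hv) ((norm_neg w).trans hw) hz
      (Complex.ext (by simp; linarith) (by simp; linarith))
    simpa only [SplitsIntoPairs, Complex.neg_re, hu1, hv1, hw1, hz1] using this
  · have cases : ∀ x : ℤ, Even x → 4 ∣ x ∨ 4 ∣ x - 2 := fun x hx => by
      obtain ⟨y, rfl⟩ := hx
      omega
    have hab : a + b = 4 * i - 2 := by rw [ha, hb]; ring
    have hcd : c + d = 4 * i + 2 := by rw [hc, hd]; ring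
    have ea : Even a := ⟨i - 1 - i * l - j, by rw [ha, hj]; ring⟩
    have ec : Even c := ⟨i - i * l + j + 1, by rw [hc, hj]; ring⟩
    simp only [SplitsIntoPairs, Complex.neg_re]
    rcases cases a ea with ha4 | ha4 <;> rcases cases c ec with hc4 | hc4
    · have hb4 : 4 ∣ b - 2 := by omega
      have hd4 : 4 ∣ d - 2 := by omega
      rw [halfRoot_four_mul_re_of_dvd hq ha4, halfRoot_four_mul_re_of_dvd_sub hq hb4,
        halfRoot_four_mul_re_of_dvd hq hc4, halfRoot_four_mul_re_of_dvd_sub hq hd4] at e2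
      exact .inr (.inl ⟨by linarith, by linarith⟩)
    · have hb4 : 4 ∣ b - 2 := by omega
      have hd4 : 4 ∣ d := by omega
      rw [halfRoot_four_mul_re_of_dvd hq ha4, halfRoot_four_mul_re_of_dvd_sub hq hb4,
        halfRoot_four_mul_re_of_dvd_sub hq hc4, halfRoot_four_mul_re_of_dvd hq hd4] at e2
      exact .inr (.inr ⟨by linarith, by linarith⟩)
    · have hb4 : 4 ∣ b := by omega
      have hd4 : 4 ∣ d - 2 := by omega
      rw [halfRoot_four_mul_re_of_dvd_sub hq ha4, halfRoot_four_mul_re_of_dvd hq hb4,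
        halfRoot_four_mul_re_of_dvd hq hc4, halfRoot_four_mul_re_of_dvd_sub hq hd4] at e2
      exact .inr (.inr ⟨by linarith, by linarith⟩)
    · have hb4 : 4 ∣ b := by omega
      have hd4 : 4 ∣ d := by omega
      rw [halfRoot_four_mul_re_of_dvd_sub hq ha4, halfRoot_four_mul_re_of_dvd hq hb4,
        halfRoot_four_mul_re_of_dvd_sub hq hc4, halfRoot_four_mul_re_of_dvd hq hd4] at e2
      exact .inr (.inl ⟨by linarith, by linarith⟩)

theorem dvd_of_halfRoot_re_eq {n : ℕ} (hn : n ≠ 0) {x y : ℤ}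
    (h : (halfRoot n x).re = (halfRoot n y).re) :
    (2 * n : ℤ) ∣ x - y ∨ (2 * n : ℤ) ∣ x + y := by
  have hn' : (n : ℝ) ≠ 0 := Nat.cast_ne_zero.2 hn
  rw [halfRoot_re, halfRoot_re, cos_eq_cos_iff] at h
  obtain ⟨m, h | h⟩ := h
  · refine .inl ⟨-m, ?_⟩
    field_simp at h
    have : (x - y : ℝ) = 2 * n * -m := by linarith
    exact_mod_cast this
  · refine .inr ⟨m, ?_⟩
    field_simp at h
    have : (x + y : ℝ) = 2 * n * m := by linarith
    exact_mod_cast this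

theorem dvd_of_halfRoot_re_add_eq_zero {n : ℕ} (hn : n ≠ 0) {x y : ℤ}
    (h : (halfRoot n x).re + (halfRoot n y).re = 0) :
    (2 * n : ℤ) ∣ x - y - n ∨ (2 * n : ℤ) ∣ x + y + n := by
  have hn' : (n : ℝ) ≠ 0 := Nat.cast_ne_zero.2 hn
  have : (halfRoot n x).re = (halfRoot n (y + n)).re := by
    have h1 : π * ((y + n : ℤ) : ℝ) / n = π * y / n + π := by
      push_cast
      field_simp
    rw [halfRoot_re n (y + n), h1, cos_add_pi, ← halfRoot_re]
    linarith
  simpa only [sub_add_eq_sub_sub, add_assoc] using dvd_of_halfRoot_re_eq hn this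

theorem not_splitsIntoPairs {n k l : ℕ} (hk : 2 ≤ k) (hkn : 2 * k < n)
    (hl : 2 ≤ l) (hln : l ≤ n - 2) (hpar : ¬ (Even n ∧ Odd k))
    (hexc : ¬ ∃ j : ℕ, 2 ≤ j ∧ j ≤ n - 2 ∧ n = 2 * (k + j) ∧
      (n : ℤ) ∣ ((k : ℤ) - 1) * ((j : ℤ) - 1))
    {a b c d : ℤ} (ha : a = k - 1 - l * (k + 1)) (hb : b = k - 1 + l * (k + 1))
    (hc : c = k + 1 - l * (k - 1)) (hd : d = k + 1 + l * (k - 1)) :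
    ¬ SplitsIntoPairs (halfRoot n a).re (-halfRoot n b).re (-halfRoot n c).re
      (halfRoot n d).re := by
  have hn : n ≠ 0 := by omega
  have half : ∀ {x : ℤ}, (2 * n : ℤ) ∣ 2 * x → (n : ℤ) ∣ x :=
    fun h => Int.dvd_of_mul_dvd_mul_left (by norm_num) h
  have small : ∀ {x : ℤ}, 0 < x → x < n → ¬ (n : ℤ) ∣ x :=
    fun h0 h1 h => absurd (Int.le_of_dvd h0 h) (not_le.2 h1)
  simp only [SplitsIntoPairs, Complex.neg_re]
  rintro (⟨h1, h2⟩ | ⟨h1, h2⟩ | ⟨h1, h2⟩)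
  · replace h1 := dvd_of_halfRoot_re_eq hn (by linarith : (halfRoot n b).re = (halfRoot n a).re)
    replace h2 := dvd_of_halfRoot_re_eq hn (by linarith : (halfRoot n d).re = (halfRoot n c).re)
    rw [ha, hb] at h1
    rw [hc, hd] at h2
    replace h1 : (n : ℤ) ∣ l * (k + 1) := by
      rcases h1 with h1 | h1
      · exact half (by convert h1 using 1; ring)
      · exact absurd (half (x := k - 1) (by convert h1 using 1; ring)) (small (by omega) (by omega))
    replace h2 : (n : ℤ) ∣ l * (k - 1) := by
      rcases h2 with h2 | h2
      · exact half (by convert h2 using 1; ring)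
      · exact absurd (half (x := k + 1) (by convert h2 using 1; ring)) (small (by omega) (by omega))
    have h3 : (n : ℤ) ∣ 2 * l := (dvd_sub h1 h2).trans (dvd_of_eq (by ring))
    obtain ⟨s, hs⟩ := h3
    have hs1 : s = 1 := by
      have : 0 < s := by by_contra! h; nlinarith
      have : s < 2 := by by_contra! h; nlinarith [(by omega : (l : ℤ) < n)]
      omega
    subst hs1
    obtain ⟨s, hs'⟩ := h1
    have hk1 : (k : ℤ) + 1 = 2 * s := by
      refine mul_left_cancel₀ (a := (l : ℤ)) (by omega) ?_
      rw [hs']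
      linear_combination -s * hs
    exact hpar ⟨⟨l, by omega⟩, ⟨(s - 1).toNat, by omega⟩⟩
  · replace h1 := dvd_of_halfRoot_re_eq hn (by linarith : (halfRoot n c).re = (halfRoot n a).re)
    replace h2 := dvd_of_halfRoot_re_eq hn (by linarith : (halfRoot n b).re = (halfRoot n d).re)
    rw [ha, hc] at h1
    rw [hb, hd] at h2
    replace h1 : (n : ℤ) ∣ k - k * l := by
      rcases h1 with h1 | h1
      · exact absurd (half (x := l + 1) (by convert h1 using 1; ring)) (small (by omega) (by omega))
      · exact half (by convert h1 using 1; ring)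
    replace h2 : (n : ℤ) ∣ k + k * l := by
      rcases h2 with h2 | h2
      · exact absurd (half (x := l - 1) (by convert h2 using 1; ring)) (small (by omega) (by omega))
      · exact half (by convert h2 using 1; ring)
    exact small (x := 2 * k) (by omega) (by omega) ((dvd_add h1 h2).trans (dvd_of_eq (by ring)))
  · replace h1 := dvd_of_halfRoot_re_add_eq_zero hn h1
    replace h2 := dvd_of_halfRoot_re_add_eq_zero hn
      (by linarith : (halfRoot n b).re + (halfRoot n c).re = 0)
    rw [ha, hd] at h1
    rw [hb, hc] at h2
    obtain ⟨h, rfl⟩ : 2 ∣ n := by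
      have : (2 : ℤ) ∣ n := by
        rcases h1 with ⟨s, hs⟩ | ⟨s, hs⟩
        · exact ⟨-1 - l * k - n * s, by linear_combination -hs⟩
        · exact ⟨n * s - (k - l), by linear_combination hs⟩
      exact_mod_cast this
    push_cast at h1 h2 half small
    replace h1 : (2 * h : ℤ) ∣ 1 + l * k + h ∨ (2 * h : ℤ) ∣ k - l + h := by
      refine h1.imp (fun h1 => ?_) fun h1 => ?_
      · rw [← dvd_neg]
        exact half (by convert h1 using 1; ring)
      · exact half (by convert h1 using 1; ring)
    replace h2 : (2 * h : ℤ) ∣ l * k - 1 - h ∨ (2 * h : ℤ) ∣ k + l + h := by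
      refine h2.imp (fun h2 => ?_) fun h2 => ?_
      · exact half (by convert h2 using 1; ring)
      · exact half (by convert h2 using 1; ring)
    have hkl : (2 * h : ℤ) ∣ k + l + h → k + l = h := by
      rintro ⟨s, hs⟩
      have : 0 < s := by by_contra! hs0; nlinarith
      have : s < 2 := by by_contra! hs2; nlinarith [(by omega : (k + l : ℤ) < 3 * h)]
      obtain rfl : s = 1 := by omega
      omega
    have hlk : (2 * h : ℤ) ∣ k - l + h → l = k + h := by
      rintro ⟨s, hs⟩
      have : -1 < s := by by_contra! hs0; nlinarith [(by omega : (l : ℤ) < 2 * h)]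
      have : s < 1 := by by_contra! hs1; nlinarith [(by omega : (k : ℤ) < h)]
      obtain rfl : s = 0 := by omega
      omega
    rcases h1 with h1 | h1 <;> rcases h2 with h2 | h2
    · refine small (x := 2) (by norm_num) (by omega) ?_
      exact (dvd_sub (dvd_sub h1 h2) (dvd_refl (2 * h : ℤ))).trans (dvd_of_eq (by ring))
    · have := hkl h2
      refine hexc ⟨l, hl, hln, by omega, ?_⟩
      push_cast
      exact (dvd_sub h1 h2).trans (dvd_of_eq (by ring))
    · have := hlk h1
      subst this
      refine hexc ⟨h - k, by omega, by omega, by omega, ?_⟩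
      rw [Nat.cast_sub (by omega)]
      push_cast at h2 ⊢
      exact (dvd_sub (dvd_mul_right (2 * h : ℤ) (k - 1)) h2).trans (dvd_of_eq (by ring))
    · have := hkl h2
      have := hlk h1
      omega

theorem Nat.dvd_prod_of_squarefree {n : ℕ} (hn : Squarefree n) {s : Finset ℕ}
    (hs : ∀ p, p.Prime → p ∣ n → p ∈ s) : n ∣ ∏ p ∈ s, p := by
  rw [← Nat.prod_primeFactors_of_squarefree hn]
  exact Finset.prod_dvd_prod_of_subset _ _ _ fun p hp =>
    hs p (Nat.prime_of_mem_primeFactors hp) (Nat.dvd_of_mem_primeFactors hp)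

theorem conjugateSum_ne_zero {n k l : ℕ} (h5 : 5 ≤ n) (hk : 2 ≤ k) (hkn : 2 * k < n)
    (hl : 2 ≤ l) (hln : l ≤ n - 2) (hpar : ¬ (Even n ∧ Odd k))
    (hexc : ¬ ∃ j : ℕ, 2 ≤ j ∧ j ≤ n - 2 ∧ n = 2 * (k + j) ∧
      (n : ℤ) ∣ ((k : ℤ) - 1) * ((j : ℤ) - 1)) :
    conjugateSum n (k - 1 - l * (k + 1)) (k - 1 + l * (k + 1)) (k + 1 - l * (k - 1))
      (k + 1 + l * (k - 1)) 1 ≠ 0 := by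
  intro h
  have hn : n ≠ 0 := by omega
  have hsplit := not_splitsIntoPairs hk hkn hl hln hpar hexc rfl rfl rfl rfl
  have h4 : ¬ 4 ∣ n := fun h4 => hsplit <|
    splitsIntoPairs_of_four_dvd hn (by omega) (by omega) rfl rfl rfl rfl h h4 <|
      Nat.not_odd_iff_even.1 fun hk => hpar ⟨by rw [Nat.even_iff]; omega, hk⟩
  have hodd : ∀ p : ℕ, p.Prime → p ≠ 2 → p ∣ n → ¬ (p * p ∣ n ∨ 11 ≤ p) :=
    fun p hp hp2 hpn hpm => hsplit <|
      splitsIntoPairs_of_prime hn (by omega) (by omega) rfl rfl rfl rfl h hp hp2 hpn hpm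
  have hsq : Squarefree n := by
    rw [Nat.squarefree_iff_prime_squarefree]
    intro p hp hpn
    by_cases hp2 : p = 2
    · subst hp2
      exact h4 hpn
    · exact hodd p hp hp2 (dvd_of_mul_left_dvd hpn) (.inl hpn)
  have h210 : n ∣ 210 := by
    refine Nat.dvd_prod_of_squarefree (s := {2, 3, 5, 7}) hsq fun p hp hpn => ?_
    by_cases hp2 : p = 2
    · simp [hp2]
    have h11 : p < 11 := not_le.1 fun h => hodd p hp hp2 hpn (.inr h)
    interval_cases p <;> first | (norm_num at hp; done) | simp
  have hrel := relation_eq_conjugateSum n k l 1 (by omega) (by omega) (ζ := halfRoot n 2) (by simp)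
  rw [Nat.cast_one, h, mul_zero, neg_zero] at hrel
  rcases exceptional_of_dvd_two_hundred_ten h5 h210 hk hkn hpar hl hln fun g hg =>
    relation_of_primitiveRoot (by omega) (isPrimitiveRoot_halfRoot hn) k l hrel hg with
    ⟨h1, h2⟩ | ⟨h1, h2⟩
  · refine hexc ⟨l, hl, hln, h1, ?_⟩
    have := Int.natCast_dvd_natCast.2 h2
    rwa [Nat.cast_mul, Nat.cast_pred (by omega), Nat.cast_pred (by omega)] at this
  · refine hexc ⟨n - l, by omega, by omega, h1, ?_⟩
    have := Int.natCast_dvd_natCast.2 h2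
    rwa [Nat.cast_mul, Nat.cast_pred (by omega), Nat.cast_pred (by omega)] at this

theorem halfRoot_sub_halfRoot_neg (n : ℕ) (x : ℤ) :
    halfRoot n x - halfRoot n (-x) = 2 * Complex.I * (sin (π * x / n) : ℝ) := by
  rw [← conj_halfRoot, Complex.sub_conj, halfRoot, Complex.exp_ofReal_mul_I_im]
  push_cast
  ring

theorem stdAddChar_intCast (n : ℕ) [NeZero n] (j : ℤ) :
    ZMod.stdAddChar (j : ZMod n) = halfRoot n (2 * j) := by
  rw [ZMod.stdAddChar_coe, halfRoot]
  push_cast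
  ring_nf

/-- The eigenvalue of the linearized system on the Fourier mode `y`. -/
noncomputable def eigenvalue (n k : ℕ) [NeZero n] (y : ZMod n) : ℂ :=
  (sin (π * (k - 1) / n) : ℝ) * (1 - ZMod.stdAddChar (((k : ZMod n) + 1) * y))
    - (sin (π * (k + 1) / n) : ℝ) * (ZMod.stdAddChar y - ZMod.stdAddChar ((k : ZMod n) * y))

theorem two_I_mul_eigenvalue (n k l : ℕ) [NeZero n] :
    2 * Complex.I * eigenvalue n k (l : ZMod n) = halfRoot n (l * (k + 1)) *
      conjugateSum n (k - 1 - l * (k + 1)) (k - 1 + l * (k + 1)) (k + 1 - l * (k - 1))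
        (k + 1 + l * (k - 1)) 1 := by
  have h1 := halfRoot_sub_halfRoot_neg n (k - 1)
  have h2 := halfRoot_sub_halfRoot_neg n (k + 1)
  have e1 := stdAddChar_intCast n ((k + 1) * l)
  have e2 := stdAddChar_intCast n l
  have e3 := stdAddChar_intCast n (k * l)
  have e0 : halfRoot n 0 = 1 := by simp [halfRoot]
  push_cast at h1 h2 e1 e2 e3
  have : 2 * Complex.I * eigenvalue n k (l : ZMod n) =
      (halfRoot n (k - 1) - halfRoot n (-(k - 1))) * (halfRoot n 0 - halfRoot n (2 * ((k + 1) * l)))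
        - (halfRoot n (k + 1) - halfRoot n (-(k + 1)))
          * (halfRoot n (2 * l) - halfRoot n (2 * (k * l))) := by
    rw [h1, h2, e0, eigenvalue, e1, e2, e3]
    push_cast
    ring
  rw [this]
  simp only [conjugateSum, mul_add, mul_sub, sub_mul, ← halfRoot_add]
  ring_nf

theorem dft_shift {n : ℕ} [NeZero n] (Φ : ZMod n → ℂ) (t y : ZMod n) :
    ∑ x, ZMod.stdAddChar (-(x * y)) * Φ (x + t) = ZMod.stdAddChar (t * y) * ZMod.dft Φ y := by
  rw [ZMod.dft_apply, Finset.mul_sum]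
  refine Fintype.sum_equiv (Equiv.addRight t) _ _ fun x => ?_
  rw [Equiv.coe_addRight, smul_eq_mul, ← mul_assoc, ← AddChar.map_add_eq_mul]
  ring_nf

theorem eigenvalue_mul_dft_eq_zero {n k : ℕ} [NeZero n] {Φ : ZMod n → ℂ}
    (h : ∀ x : ZMod n, (sin (π * (k - 1) / n) : ℝ) * Φ x
      - (sin (π * (k + 1) / n) : ℝ) * Φ (x + 1) + (sin (π * (k + 1) / n) : ℝ) * Φ (x + k)
      - (sin (π * (k - 1) / n) : ℝ) * Φ (x + k + 1) = 0) (y : ZMod n) :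
    eigenvalue n k y * ZMod.dft Φ y = 0 := by
  rw [eigenvalue]
  generalize ((sin (π * (k - 1) / n) : ℝ) : ℂ) = s₁ at h ⊢
  generalize ((sin (π * (k + 1) / n) : ℝ) : ℂ) = s₂ at h ⊢
  have h0 := dft_shift Φ 0 y
  have h1 := dft_shift Φ 1 y
  have h2 := dft_shift Φ k y
  have h3 := dft_shift Φ (k + 1) y
  simp only [add_zero, zero_mul, one_mul, AddChar.map_zero_eq_one] at h0 h1
  have hsum : ∑ x, ZMod.stdAddChar (-(x * y)) * (s₁ * Φ x - s₂ * Φ (x + 1) + s₂ * Φ (x + k)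
      - s₁ * Φ (x + k + 1)) = 0 :=
    Finset.sum_eq_zero fun x _ => by rw [h x, mul_zero]
  simp only [mul_add, mul_sub, Finset.sum_add_distrib, Finset.sum_sub_distrib, add_assoc,
    mul_left_comm (ZMod.stdAddChar _), ← Finset.mul_sum, h0, h1, h2, h3] at hsum
  linear_combination hsum

/-- The real part of a function on `ZMod n` whose Fourier transform is supported on the modes `0`,
`1` and `-1` is a trigonometric polynomial of degree one. -/
theorem exists_trig_of_dft_eq_zero {n : ℕ} [NeZero n] (hn : 3 ≤ n) {Φ : ZMod n → ℂ}
    (h : ∀ y, y ≠ 0 → y ≠ 1 → y ≠ -1 → ZMod.dft Φ y = 0) :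
    ∃ A B D : ℝ, ∀ j : ℤ, (Φ j).re = A + B * cos (π * (2 * (j : ℝ) - 1) / n)
      + D * sin (π * (2 * (j : ℝ) - 1) / n) := by
  set F := ZMod.dft Φ with hF
  let G₁ := (n : ℂ)⁻¹ * (halfRoot n 1 * F 1)
  let G₂ := (n : ℂ)⁻¹ * (halfRoot n (-1) * F (-1))
  refine ⟨((n : ℂ)⁻¹ * F 0).re, G₁.re + G₂.re, G₂.im - G₁.im, fun j => ?_⟩
  have : Fact (2 < n) := ⟨hn⟩
  have : Fact (1 < n) := ⟨by omega⟩
  have h11 : (1 : ZMod n) ≠ -1 := ZMod.neg_one_ne_one.symm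
  have hinv : Φ j = ZMod.dft.symm F j := by rw [hF, LinearEquiv.symm_apply_apply]
  rw [ZMod.invDFT_apply, ← Finset.sum_subset (Finset.subset_univ {0, 1, -1})
    (fun y _ hy => by
      simp only [Finset.mem_insert, Finset.mem_singleton, not_or] at hy
      rw [h y hy.1 hy.2.1 hy.2.2, smul_zero]),
    Finset.sum_insert (by simp), Finset.sum_insert (by simpa using h11),
    Finset.sum_singleton] at hinv
  have e1 : ZMod.stdAddChar (1 * (j : ZMod n)) = halfRoot n 1 * halfRoot n (2 * j - 1) := by
    rw [one_mul, stdAddChar_intCast, ← halfRoot_add]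
    ring_nf
  have e2 : ZMod.stdAddChar (-1 * (j : ZMod n)) =
      halfRoot n (-1) * (starRingEnd ℂ) (halfRoot n (2 * j - 1)) := by
    have := stdAddChar_intCast n (-1 * j)
    push_cast at this
    rw [this, conj_halfRoot, ← halfRoot_add]
    ring_nf
  have hw : halfRoot n (2 * j - 1) = ⟨cos (π * (2 * (j : ℝ) - 1) / n),
      sin (π * (2 * (j : ℝ) - 1) / n)⟩ := by
    refine Complex.ext ?_ ?_
    · rw [halfRoot_re]
      push_cast
      rfl
    · rw [halfRoot, Complex.exp_ofReal_mul_I_im]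
      push_cast
      rfl
  have hΦ : Φ j = (n : ℂ)⁻¹ * F 0 + G₁ * halfRoot n (2 * j - 1)
      + G₂ * (starRingEnd ℂ) (halfRoot n (2 * j - 1)) := by
    rw [hinv, e1, e2]
    simp only [zero_mul, AddChar.map_zero_eq_one, smul_eq_mul, G₁, G₂]
    ring
  rw [hΦ, Complex.add_re, Complex.add_re, Complex.mul_re G₁, Complex.mul_re G₂, Complex.conj_re,
    Complex.conj_im, hw]
  ring

/-- Theorem 5.7 (infinitesimal rigidity of regular polygons): if none of the
exceptional cases holds, then every solution of the linearized self-Bäcklund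
system `μ_{k−1} c_j − μ_{k+1} c_{j+1} + μ_{k+1} c_{j+k} − μ_{k−1} c_{j+k+1} = C`
(with `μ_m = sin(πm/n)` and `c` an `n`-periodic sequence) has `C = 0` and is
a trivial solution coming from the action of `sl(2, ℝ)`. -/
theorem stmt19 (n k : ℕ) (hn : 5 ≤ n) (hk2 : 2 ≤ k) (hkn : 2 * k ≤ n)
    (h1 : ¬ (Even n ∧ Odd k))
    (h2 : ¬ (n = 2 * k ∧ Even k ∧ 2 < k))
    (h3 : ¬ ∃ j : ℕ, 2 ≤ j ∧ j ≤ n - 2 ∧ n = 2 * (k + j) ∧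
        (n : ℤ) ∣ ((k : ℤ) - 1) * ((j : ℤ) - 1))
    (c : ℤ → ℝ) (hper : ∀ j : ℤ, c (j + n) = c j) (C : ℝ)
    (heq : ∀ j : ℤ,
        Real.sin (π * ((k : ℝ) - 1) / n) * c j
          - Real.sin (π * ((k : ℝ) + 1) / n) * c (j + 1)
          + Real.sin (π * ((k : ℝ) + 1) / n) * c (j + k)
          - Real.sin (π * ((k : ℝ) - 1) / n) * c (j + k + 1) = C) :
    C = 0 ∧ ∃ A B D : ℝ, ∀ j : ℤ,
      c j = A + B * Real.cos (π * (2 * (j : ℝ) - 1) / n)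
              + D * Real.sin (π * (2 * (j : ℝ) - 1) / n) := by
  have hkn' : 2 * k < n := by
    refine lt_of_le_of_ne hkn fun h => ?_
    rcases Nat.even_or_odd k with hk | hk
    · exact h2 ⟨h.symm, hk, by omega⟩
    · exact h1 ⟨⟨k, by omega⟩, hk⟩
  have : NeZero n := ⟨by omega⟩
  let Φ : ZMod n → ℂ := fun x => (c x.val : ℝ)
  have hΦ : ∀ j : ℤ, Φ j = c j := fun j => by
    have hp : Function.Periodic c n := hper
    simp only [Φ, ZMod.val_intCast]
    rw [Int.emod_def, mul_comm]
    exact congrArg _ (by simpa using hp.sub_int_mul_eq (x := j) (j / n))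
  have hsys : ∀ x : ZMod n, (sin (π * (k - 1) / n) : ℝ) * Φ x
      - (sin (π * (k + 1) / n) : ℝ) * Φ (x + 1) + (sin (π * (k + 1) / n) : ℝ) * Φ (x + k)
      - (sin (π * (k - 1) / n) : ℝ) * Φ (x + k + 1) = C := fun x => by
    obtain ⟨j, rfl⟩ := ZMod.intCast_surjective x
    have e1 := hΦ (j + 1)
    have e2 := hΦ (j + k)
    have e3 := hΦ (j + k + 1)
    push_cast at e1 e2 e3
    rw [hΦ, e1, e2, e3]
    exact_mod_cast heq j
  have hC : C = 0 := by
    have hshift : ∀ t : ZMod n, ∑ x, Φ (x + t) = ∑ x, Φ x :=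
      fun t => Equiv.sum_comp (Equiv.addRight t) Φ
    have hsum := Finset.sum_congr (s₁ := Finset.univ) rfl fun x _ => hsys x
    simp only [Finset.sum_add_distrib, Finset.sum_sub_distrib, ← Finset.mul_sum, add_assoc,
      hshift, Finset.sum_const, Finset.card_univ, ZMod.card, nsmul_eq_mul] at hsum
    have h0 : (n : ℂ) * C = 0 := by linear_combination -hsum
    simpa [NeZero.ne n] using h0
  subst hC
  refine ⟨rfl, ?_⟩
  have hdft : ∀ y : ZMod n, y ≠ 0 → y ≠ 1 → y ≠ -1 → ZMod.dft Φ y = 0 := fun y h0 hy1 hy2 => by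
    refine (mul_eq_zero.1 (eigenvalue_mul_dft_eq_zero (by simpa using hsys) y)).resolve_left ?_
    intro hev
    have hl0 : y.val ≠ 0 := fun h => h0 ((ZMod.val_eq_zero y).1 h)
    have hy := ZMod.natCast_zmod_val y
    have hl1 : y.val ≠ 1 := fun h => hy1 (by rw [← hy, h, Nat.cast_one])
    have hl2 : y.val ≠ n - 1 := fun h => hy2 (by
      rw [← hy, h, Nat.cast_pred (by omega), ZMod.natCast_self, zero_sub])
    have hlt := ZMod.val_lt y
    have := two_I_mul_eigenvalue n k y.val
    rw [hy, hev, mul_zero, eq_comm, mul_eq_zero] at this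
    rcases this with h | h
    · exact halfRoot_ne_zero _ _ h
    · exact conjugateSum_ne_zero hn hk2 hkn' (by omega) (by omega) h1 h3 h
  obtain ⟨A, B, D, h⟩ := exists_trig_of_dft_eq_zero (by omega) hdft
  exact ⟨A, B, D, fun j => by rw [← h j, hΦ, Complex.ofReal_re]⟩
end
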